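/- Let K be an algebraically closed field, L a nonzero finitely generated graded K[x_1,…,x_m]-module and N a nonzero finitely generated graded K[y_1,…,y_n]-module, and regard M = L ⊗_K N as a finitely generated bigraded S-module. Then M has maximal depth with respect to Q if and only if N has maximal depth (i.e. depth_{K[y]} N = min{dim K[y]/p : p ∈ Ass_{K[y]}(N)}). -/

import Mathlib

open CategoryTheory MvPolynomial

noncomputable section

/-- The standard bigraded polynomial ring `S = K[x_1,…,x_m, y_1,…,y_n]`. -/
abbrev BGS (K : Type) [Field K] (m n : ℕ) : Type := MvPolynomial (Fin m ⊕ Fin n) K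

/-- The bigrading weights: `deg x_i = (1,0)`, `deg y_j = (0,1)`. -/
def bwt (m n : ℕ) : Fin m ⊕ Fin n → ℕ × ℕ := Sum.elim (fun _ => (1, 0)) (fun _ => (0, 1))

/-- `P = (x_1, …, x_m)`. -/
def idealP (K : Type) [Field K] (m n : ℕ) : Ideal (BGS K m n) :=
  Ideal.span (Set.range fun i : Fin m => (X (Sum.inl i) : BGS K m n))

/-- `Q = (y_1, …, y_n)`. -/
def idealQ (K : Type) [Field K] (m n : ℕ) : Ideal (BGS K m n) :=
  Ideal.span (Set.range fun j : Fin n => (X (Sum.inr j) : BGS K m n))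

/-- `cd(J, M)`: the cohomological dimension, i.e. the largest `i` such that the local
cohomology module `H^i_J(M)` is nonzero. -/
def cohDim (R : Type) [CommRing R] (J : Ideal R) (M : Type) [AddCommGroup M] [Module R M] : ℕ :=
  sSup {i : ℕ | Nontrivial ((localCohomology J i).obj (ModuleCat.of R M))}

/-- `grade(J, M)`: the least `i` with `Ext^i(R/J, M) ≠ 0`. -/
def extGrade (R : Type) [CommRing R] (J : Ideal R) (M : Type) [AddCommGroup M] [Module R M] : ℕ :=
  sInf {i : ℕ | Nontrivial
    (((Ext R (ModuleCat R) i).obj (Opposite.op (ModuleCat.of R (R ⧸ J)))).obj (ModuleCat.of R M))}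

/-- `mgrade(J, M) = min {cd(J, R/p) : p ∈ Ass(M)}`. -/
def mCohDim (R : Type) [CommRing R] (J : Ideal R) (M : Type) [AddCommGroup M] [Module R M] : ℕ :=
  sInf ((fun p => cohDim R J (R ⧸ p)) '' associatedPrimes R M)

/-- `M` has maximal depth with respect to `J` if `grade(J, M) = mgrade(J, M)`. -/
def HasMaximalDepth (R : Type) [CommRing R] (J : Ideal R) (M : Type) [AddCommGroup M]
    [Module R M] : Prop :=
  extGrade R J M = mCohDim R J M

/-- A bigrading on an `S`-module `M`: an internal direct sum decomposition indexed by `ℕ × ℕ`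
compatible with the bigrading of `S`. -/
structure IsBigrading (K : Type) [Field K] (m n : ℕ) (M : Type) [AddCommGroup M]
    [Module (BGS K m n) M] (ℳ : ℕ × ℕ → AddSubgroup M) : Prop where
  internal : DirectSum.IsInternal ℳ
  smul_mem : ∀ (d e : ℕ × ℕ) (s : BGS K m n) (x : M),
    IsWeightedHomogeneous (bwt m n) s d → x ∈ ℳ e → s • x ∈ ℳ (d + e)

/-- A submodule is bigraded if it is generated by bihomogeneous elements. -/
def IsBigradedSubmodule (K : Type) [Field K] (m n : ℕ) {M : Type} [AddCommGroup M]
    [Module (BGS K m n) M] (ℳ : ℕ × ℕ → AddSubgroup M) (N : Submodule (BGS K m n) M) : Prop :=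
  N = Submodule.span (BGS K m n) {x : M | x ∈ N ∧ ∃ d, x ∈ ℳ d}

open TensorProduct in
/-- A (standard) grading on a module over a polynomial ring. -/
structure IsMvGrading (K : Type) [Field K] (σ : Type) (L : Type) [AddCommGroup L]
    [Module (MvPolynomial σ K) L] (ℒ : ℕ → AddSubgroup L) : Prop where
  internal : DirectSum.IsInternal ℒ
  smul_mem : ∀ (d e : ℕ) (φ : MvPolynomial σ K) (x : L),
    φ.IsHomogeneous d → x ∈ ℒ e → φ • x ∈ ℒ (d + e)


namespace MaxDepthAux
open Opposite

section Bridge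
variable {R : Type} [CommRing R]

section generic
variable (K : ChainComplex (ModuleCat.{0} R)ᵒᵖ ℕ)

lemma gI_inj (n : ℕ) : Function.Injective (K.pOpcycles n).unop := by
  rw [← ModuleCat.mono_iff_injective]
  infer_instance

lemma gPi_surj (n : ℕ) : Function.Surjective (K.homologyι n).unop := by
  rw [← ModuleCat.epi_iff_surjective]
  infer_instance

lemma gI_range (n : ℕ) (f : (K.X n).unop) :
    (∃ z, (K.pOpcycles n).unop z = f) ↔ (K.d (n+1) n).unop f = 0 := by
  have h := (K.opcyclesIsCokernel (n+1) n (by simp))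
  have hex : (ShortComplex.mk (K.d (n+1) n) (K.pOpcycles n) (K.d_pOpcycles _ _)).Exact :=
    ShortComplex.exact_of_g_is_cokernel _ h
  have h2 := hex.unop
  rw [ShortComplex.moduleCat_exact_iff] at h2
  constructor
  · rintro ⟨z, rfl⟩
    have : (K.pOpcycles n).unop ≫ (K.d (n+1) n).unop = 0 := by
      rw [← unop_comp]; simp
    exact congrArg (fun f => f.hom z) this
  · intro hf
    exact h2 f hf

lemma gPi_zero (n : ℕ) (z : (K.opcycles (n+1)).unop) :
    (K.homologyι (n+1)).unop z = 0 ↔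
      ∃ g : (K.X n).unop, (K.d (n+1) n).unop g = (K.pOpcycles (n+1)).unop z := by
  have h := (K.homologyIsKernel (n+1) n (by simp))
  have hex : (ShortComplex.mk (K.homologyι (n+1)) (K.fromOpcycles (n+1) n) (by simp)).Exact :=
    ShortComplex.exact_of_f_is_kernel _ h
  have h2 := hex.unop
  rw [ShortComplex.moduleCat_exact_iff] at h2
  have key : ∀ g : (K.X n).unop,
      (K.pOpcycles (n+1)).unop ((K.fromOpcycles (n+1) n).unop g) = (K.d (n+1) n).unop g := by
    intro g
    have : (K.fromOpcycles (n+1) n).unop ≫ (K.pOpcycles (n+1)).unop = (K.d (n+1) n).unop := by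
      rw [← unop_comp]; simp
    exact congrArg (fun f => f.hom g) this
  constructor
  · intro hz
    obtain ⟨g, hg⟩ := h2 z hz
    exact ⟨g, (key g).symm.trans (congrArg _ hg)⟩
  · rintro ⟨g, hg⟩
    have := gI_inj K _ ((key g).trans hg)
    rw [← this]
    have : (K.fromOpcycles (n+1) n).unop ≫ (K.homologyι (n+1)).unop = 0 := by
      rw [← unop_comp]; simp
    exact congrArg (fun f => f.hom g) this

lemma gPi_zero0 (z : (K.opcycles 0).unop) :
    (K.homologyι 0).unop z = 0 ↔ (K.pOpcycles 0).unop z = 0 := by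
  have : Mono (K.homologyι 0).unop := by
    have : IsIso (K.homologyι 0) := K.isIso_homologyι 0 0 (by simp) (by simp)
    infer_instance
  rw [map_eq_zero_iff _ ((ModuleCat.mono_iff_injective _).1 this),
    map_eq_zero_iff _ (gI_inj _ _)]

end generic

abbrev yF (Y : ModuleCat.{0} R) : ModuleCat.{0} R ⥤ (ModuleCat.{0} R)ᵒᵖ :=
  ((linearYoneda R (ModuleCat.{0} R)).obj Y).rightOp

abbrev yK {X : ModuleCat.{0} R} (P : ProjectiveResolution X) (Y : ModuleCat.{0} R) :
    ChainComplex (ModuleCat.{0} R)ᵒᵖ ℕ :=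
  ((yF Y).mapHomologicalComplex _).obj P.complex

abbrev Leg (X Y : ModuleCat.{0} R) (n : ℕ) : ModuleCat.{0} R :=
  ((_root_.Ext R (ModuleCat.{0} R) n).obj (op X)).obj Y

/-- `LR P f ξ` : the cocycle `f` represents the class `ξ`. -/
def LR {X Y : ModuleCat.{0} R} (P : ProjectiveResolution X) {n : ℕ}
    (f : P.complex.X n ⟶ Y) (ξ : Leg X Y n) : Prop :=
  ∃ z : ((yK P Y).opcycles n).unop, ((yK P Y).pOpcycles n).unop z = f ∧
    (P.isoLeftDerivedObj (yF Y) n).hom.unop (((yK P Y).homologyι n).unop z) = ξ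

lemma LR_ex {X Y : ModuleCat.{0} R} (P : ProjectiveResolution X) {n : ℕ} (ξ : Leg X Y n) :
    ∃ f : P.complex.X n ⟶ Y, P.complex.d (n+1) n ≫ f = 0 ∧ LR P f ξ := by
  have h1 := (ModuleCat.epi_iff_surjective (P.isoLeftDerivedObj (yF Y) n).hom.unop).1 inferInstance
  obtain ⟨w, hw⟩ := h1 ξ
  obtain ⟨z, hz⟩ := gPi_surj _ n w
  exact ⟨((yK P Y).pOpcycles n).unop z, (gI_range _ _ _).1 ⟨z, rfl⟩, z, rfl, by rw [hz, hw]⟩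

lemma LR_ex' {X Y : ModuleCat.{0} R} (P : ProjectiveResolution X) {n : ℕ}
    (f : P.complex.X n ⟶ Y) (hf : P.complex.d (n+1) n ≫ f = 0) :
    ∃ ξ : Leg X Y n, LR P f ξ := by
  obtain ⟨z, hz⟩ := (gI_range (yK P Y) n f).2 hf
  exact ⟨_, z, hz, rfl⟩

lemma extMk0 {X Y : ModuleCat.{0} R} (P : ProjectiveResolution X)
    (f : P.complex.X 0 ⟶ Y) (hf : P.complex.d (0+1) 0 ≫ f = 0) :
    f = 0 ↔ P.extMk f (0+1) rfl hf = 0 := by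
  constructor
  · rintro rfl
    exact P.extMk_zero _ _
  · intro h
    rw [← P.extEquivCohomologyClass.apply_eq_iff_eq] at h
    rw [ProjectiveResolution.extEquivCohomologyClass_extMk, 
      ProjectiveResolution.extEquivCohomologyClass_zero,
      CochainComplex.HomComplex.CohomologyClass.mk_eq_zero_iff] at h
    rw [CochainComplex.HomComplex.Cocycle.toSingleMk_mem_coboundaries_iff _ _ _ _ _ 1 (by simp)] at h
    obtain ⟨g, hg⟩ := h
    have hz : Limits.IsZero (P.cochainComplex.X 1) :=
      P.cochainComplex.isZero_of_isStrictlyLE 0 1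
    rw [hz.eq_of_src g 0, Limits.comp_zero] at hg
    have := (cancel_epi (P.cochainComplexXIso (-(0:ℕ)) 0 rfl).hom).1
      (hg.symm.trans Limits.comp_zero.symm)
    exact this

lemma LR_zero {X Y : ModuleCat.{0} R} (P : ProjectiveResolution X) {n : ℕ}
    (f : P.complex.X n ⟶ Y) (ξ : Leg X Y n) (hf : P.complex.d (n+1) n ≫ f = 0) (h : LR P f ξ) :
    ξ = 0 ↔ P.extMk f (n+1) rfl hf = 0 := by
  obtain ⟨z, rfl, rfl⟩ := h
  have := (ModuleCat.mono_iff_injective (P.isoLeftDerivedObj (yF Y) n).hom.unop).1 inferInstance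
  refine Iff.trans (map_eq_zero_iff _ this) ?_
  cases n with
  | succ n =>
    refine Iff.trans (gPi_zero _ _ _) ?_
    refine Iff.trans ?_ (P.extMk_eq_zero_iff _ _ _ _ n rfl).symm
    exact Iff.rfl
  | zero =>
    refine Iff.trans (gPi_zero0 _ _) ?_
    exact extMk0 P _ hf

lemma LR_nat {X X' : ModuleCat.{0} R} (P : ProjectiveResolution X) (P' : ProjectiveResolution X')
    (g : X' ⟶ X) (φ : ProjectiveResolution.Hom P' P g) (Y : ModuleCat.{0} R) (n : ℕ) 
    (f : P.complex.X n ⟶ Y) (ξ : Leg X Y n) (h : LR P f ξ) :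
    LR P' (φ.hom.f n ≫ f) (((_root_.Ext R (ModuleCat.{0} R) n).map g.op).app Y ξ) := by
  obtain ⟨z, rfl, rfl⟩ := h
  let ψ : yK P' Y ⟶ yK P Y := ((yF Y).mapHomologicalComplex _).map φ.hom
  refine ⟨(HomologicalComplex.opcyclesMap ψ n).unop z, ?_, ?_⟩
  · have : (HomologicalComplex.opcyclesMap ψ n).unop ≫ ((yK P' Y).pOpcycles n).unop = 
        ((yK P Y).pOpcycles n).unop ≫ (ψ.f n).unop := by
      rw [← unop_comp, ← unop_comp, HomologicalComplex.p_opcyclesMap]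
    exact congrArg (fun f => f.hom z) this
  · have h1 := P'.isoLeftDerivedObj_hom_naturality g P φ.hom φ.hom_f_zero_comp_π_f_zero (yF Y) n
    have h2 : (HomologicalComplex.opcyclesMap ψ n).unop ≫ ((yK P' Y).homologyι n).unop = 
        ((yK P Y).homologyι n).unop ≫ (HomologicalComplex.homologyMap ψ n).unop := by
      rw [← unop_comp, ← unop_comp, HomologicalComplex.homologyι_naturality]
    have h3 := congrArg (fun f => f.hom z) h2
    have h4 := congrArg Quiver.Hom.unop h1
    replace h4 := congrArg (fun f => ModuleCat.Hom.hom f (((yK P Y).homologyι n).unop z)) h4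
    refine Eq.trans ?_ h4.symm
    exact congrArg _ h3

lemma leg_nontrivial_iff (X Y : ModuleCat.{0} R) (n : ℕ) :
    Nontrivial (Leg X Y n) ↔ ∃ ξ : Abelian.Ext X Y n, ξ ≠ 0 := by
  let P := projectiveResolution X
  constructor
  · intro h
    obtain ⟨ξ, hξ⟩ := exists_ne (0 : Leg X Y n)
    obtain ⟨f, hf, hr⟩ := LR_ex P ξ
    exact ⟨P.extMk f (n+1) rfl hf, fun h0 => hξ ((LR_zero P f ξ hf hr).2 h0)⟩
  · rintro ⟨ξ, hξ⟩
    obtain ⟨f, hf, rfl⟩ := P.extMk_surjective ξ (n+1) rfl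
    obtain ⟨ξ', hr⟩ := LR_ex' P f hf
    exact ⟨ξ', 0, fun h0 => hξ ((LR_zero P f ξ' hf hr).1 h0)⟩

/-- Transfer between the two kinds of Ext along a family of maps. -/
lemma leg_family (X Y : ModuleCat.{0} R) (n : ℕ) {ι : Type} (X' : ι → ModuleCat.{0} R)
    (g : ∀ i, X' i ⟶ X) :
    (∃ ξ : Leg X Y n, ∀ i, ((_root_.Ext R (ModuleCat.{0} R) n).map (g i).op).app Y ξ ≠ 0) ↔
    ∃ ξ : Abelian.Ext X Y n, ∀ i, (Abelian.Ext.mk₀ (g i)).comp ξ (zero_add n) ≠ 0 := by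
  let P := projectiveResolution X
  let P' := fun i => projectiveResolution (X' i)
  let φ : ∀ i, ProjectiveResolution.Hom (P' i) P (g i) := fun i => 
    ⟨ProjectiveResolution.lift (g i) _ _, ProjectiveResolution.lift_commutes_zero _ _ _⟩
  have key : ∀ (f : P.complex.X n ⟶ Y) (ξ : Leg X Y n) (hf : P.complex.d (n+1) n ≫ f = 0)
      (_ : LR P f ξ) (i), ((_root_.Ext R (ModuleCat.{0} R) n).map (g i).op).app Y ξ = 0 ↔
        (Abelian.Ext.mk₀ (g i)).comp (P.extMk f (n+1) rfl hf) (zero_add n) = 0 := by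
    intro f ξ hf hr i
    rw [ProjectiveResolution.mk₀_comp_extMk f (n+1) rfl hf (φ i)]
    exact LR_zero (P' i) _ _ _ (LR_nat P (P' i) (g i) (φ i) Y n f ξ hr)
  constructor
  · rintro ⟨ξ, hξ⟩
    obtain ⟨f, hf, hr⟩ := LR_ex P ξ
    exact ⟨P.extMk f (n+1) rfl hf, fun i h0 => hξ i ((key f ξ hf hr i).2 h0)⟩
  · rintro ⟨ξ, hξ⟩
    obtain ⟨f, hf, rfl⟩ := P.extMk_surjective ξ (n+1) rfl
    obtain ⟨ξ', hr⟩ := LR_ex' P f hf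
    exact ⟨ξ', fun i h0 => hξ i ((key f ξ' hf hr i).1 h0)⟩

end Bridge
end MaxDepthAux

namespace MaxDepthAux
open Opposite

section LC
variable {R : Type} [CommRing R]

lemma colim_nontrivial {J : Type} [SmallCategory J] [IsFiltered J] (F : J ⥤ ModuleCat.{0} R)
    (D : Limits.Cocone F) (hD : Limits.IsColimit D) :
    Nontrivial D.pt ↔ ∃ (j : J) (x : F.obj j), ∀ (j' : J) (i : j ⟶ j'), (F.map i).hom x ≠ 0 := by
  constructor
  · intro h
    obtain ⟨z, hz⟩ := exists_ne (0 : D.pt)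
    obtain ⟨j, x, rfl⟩ := Limits.Concrete.isColimit_exists_rep F hD z
    refine ⟨j, x, fun j' i h0 => hz ?_⟩
    have := congrArg (fun f => ModuleCat.Hom.hom f x) (D.w i)
    refine Eq.trans this.symm ?_
    exact (congrArg (D.ι.app j').hom h0).trans (map_zero _)
  · rintro ⟨j, x, hx⟩
    refine ⟨(D.ι.app j).hom x, 0, fun h0 => ?_⟩
    have h1 : (D.ι.app j).hom x = (D.ι.app j).hom 0 := by rw [h0, map_zero]
    obtain ⟨k, f, g, hfg⟩ := Limits.Concrete.isColimit_exists_of_rep_eq F hD x 0 h1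
    exact hx k f (hfg.trans (map_zero (F.map g).hom))

/-- projection `R/J → R/I` for `J ≤ I`. -/
def qproj {I J : Ideal R} (h : J ≤ I) : ModuleCat.of R (R ⧸ J) ⟶ ModuleCat.of R (R ⧸ I) :=
  ModuleCat.ofHom (Submodule.mapQ J I LinearMap.id h)

lemma lc_nontrivial (J : Ideal R) (i : ℕ) (M : ModuleCat.{0} R) :
    Nontrivial ((localCohomology J i).obj M) ↔
      ∃ (t : ℕ) (ξ : Abelian.Ext (ModuleCat.of R (R ⧸ J ^ t)) M i), ∀ (t' : ℕ) (h : t ≤ t'),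
        (Abelian.Ext.mk₀ (qproj (Ideal.pow_le_pow_right (I := J) h))).comp ξ (zero_add i) ≠ 0 := by
  let D := localCohomology.diagram (localCohomology.idealPowersDiagram J) i
  have hc := Limits.isColimitOfPreserves ((evaluation _ (ModuleCat.{0} R)).obj M)
    (Limits.colimit.isColimit D)
  refine Iff.trans (colim_nontrivial _ _ hc) ?_
  constructor
  · rintro ⟨j, ξ, h⟩
    refine ⟨unop (unop j), ?_⟩
    obtain ⟨ξ', h'⟩ := (leg_family (ModuleCat.of R (R ⧸ J ^ (unop (unop j)))) M i
      (ι := {t' : ℕ // (unop (unop j)) ≤ t'}) (fun t => ModuleCat.of R (R ⧸ J ^ t.1))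
      (fun t => qproj (Ideal.pow_le_pow_right (I := J) t.2))).1
      ⟨ξ, fun t => h (op (op t.1)) (homOfLE t.2).op.op⟩
    exact ⟨ξ', fun t' ht => h' ⟨t', ht⟩⟩
  · rintro ⟨t, ξ, h⟩
    refine ⟨op (op t), ?_⟩
    obtain ⟨ξ', h'⟩ := (leg_family (ModuleCat.of R (R ⧸ J ^ t)) M i
      (ι := {t' : ℕ // t ≤ t'}) (fun t => ModuleCat.of R (R ⧸ J ^ t.1))
      (fun t => qproj (Ideal.pow_le_pow_right (I := J) t.2))).2
      ⟨ξ, fun t => h t.1 t.2⟩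
    exact ⟨ξ', fun j' i => h' ⟨unop (unop j'), leOfHom i.unop.unop⟩⟩

lemma cohDim_eq (J : Ideal R) (M : Type) [AddCommGroup M] [Module R M] :
    cohDim R J M = sSup {i : ℕ | ∃ (t : ℕ) (ξ : Abelian.Ext (ModuleCat.of R (R ⧸ J ^ t)) (ModuleCat.of R M) i), 
      ∀ (t' : ℕ) (h : t ≤ t'),
        (Abelian.Ext.mk₀ (qproj (Ideal.pow_le_pow_right (I := J) h))).comp ξ (zero_add i) ≠ 0} := by
  unfold cohDim
  congr 1
  ext i
  exact lc_nontrivial J i _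

lemma extGrade_eq (J : Ideal R) (M : Type) [AddCommGroup M] [Module R M] :
    extGrade R J M = sInf {i : ℕ | ∃ ξ : Abelian.Ext (ModuleCat.of R (R ⧸ J)) (ModuleCat.of R M) i, ξ ≠ 0} := by
  unfold extGrade
  congr 1
  ext i
  exact leg_nontrivial_iff _ _ _
end LC
end MaxDepthAux

namespace MaxDepthAux
open Opposite

section Ext
variable {R : Type} [CommRing R]

/-- `Ext^i(X,Y)` -/
abbrev EX (R : Type) [CommRing R] (X Y : Type) [AddCommGroup X] [Module R X] [AddCommGroup Y] [Module R Y] (i : ℕ) :=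
  Abelian.Ext (ModuleCat.of R X) (ModuleCat.of R Y) i

variable {X X' X'' Y Z C : Type} [AddCommGroup X] [Module R X] [AddCommGroup X'] [Module R X']
  [AddCommGroup X''] [Module R X'']
  [AddCommGroup Y] [Module R Y] [AddCommGroup Z] [Module R Z] [AddCommGroup C] [Module R C]

/-- pullback -/
def pb (f : X →ₗ[R] Y) {i : ℕ} (ξ : EX R Y C i) : EX R X C i :=
  (Abelian.Ext.mk₀ (ModuleCat.ofHom f)).comp ξ (zero_add i)

lemma pb_add (f : X →ₗ[R] Y) {i : ℕ} (ξ η : EX R Y C i) : pb f (ξ + η) = pb f ξ + pb f η := by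
  simp [pb]
@[simp] lemma pb_zero (f : X →ₗ[R] Y) {i : ℕ} : pb f (0 : EX R Y C i) = 0 := by
  simp [pb]
lemma pb_sub (f : X →ₗ[R] Y) {i : ℕ} (ξ η : EX R Y C i) : pb f (ξ - η) = pb f ξ - pb f η := by
  have := pb_add f (ξ - η) η
  rw [sub_add_cancel] at this
  rw [this, add_sub_cancel_right]
lemma pb_smul (f : X →ₗ[R] Y) {i : ℕ} (r : R) (ξ : EX R Y C i) : pb f (r • ξ) = r • pb f ξ := by
  simp [pb]
lemma pb_id {i : ℕ} (ξ : EX R Y C i) : pb LinearMap.id ξ = ξ := by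
  have : ModuleCat.ofHom (LinearMap.id : Y →ₗ[R] Y) = 𝟙 _ := rfl
  simp [pb, this]
lemma pb_comp (f : X →ₗ[R] Y) (g : Y →ₗ[R] Z) {i : ℕ} (ξ : EX R Z C i) :
    pb (g ∘ₗ f) ξ = pb f (pb g ξ) := by
  simp only [pb, ModuleCat.ofHom_comp]
  rw [Abelian.Ext.mk₀_comp_mk₀_assoc]
lemma pb_comp_eq (f : X →ₗ[R] Y) (g : Y →ₗ[R] Z) (h : X →ₗ[R] Z) (e : g ∘ₗ f = h) {i : ℕ} (ξ : EX R Z C i) :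
    pb f (pb g ξ) = pb h ξ := by rw [← e, pb_comp]
lemma pb_lsmul (r : R) {i : ℕ} (ξ : EX R Y C i) : pb (r • LinearMap.id : Y →ₗ[R] Y) ξ = r • ξ := by
  have h : ModuleCat.ofHom (r • LinearMap.id : Y →ₗ[R] Y) = r • 𝟙 _ := rfl
  rw [pb, h, Abelian.Ext.mk₀_smul, Abelian.Ext.smul_comp, Abelian.Ext.mk₀_id_comp]

/-- the short complex -/
abbrev sc (f : X' →ₗ[R] X) (g : X →ₗ[R] X'') (h : Function.Exact f g) : ShortComplex (ModuleCat.{0} R) :=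
  ShortComplex.mk (ModuleCat.ofHom f) (ModuleCat.ofHom g) (by
    ext x; exact h.apply_apply_eq_zero x)

lemma sc_se (f : X' →ₗ[R] X) (g : X →ₗ[R] X'') (h : Function.Exact f g) (hf : Function.Injective f)
    (hg : Function.Surjective g) : (sc f g h).ShortExact where
  exact := by
    rw [ShortComplex.moduleCat_exact_iff]
    intro x hx
    exact (h x).1 hx
  mono_f := (ModuleCat.mono_iff_injective _).2 hf
  epi_g := (ModuleCat.epi_iff_surjective _).2 hg

/-- connecting map -/
def dl (f : X' →ₗ[R] X) (g : X →ₗ[R] X'') (h : Function.Exact f g) (hf : Function.Injective f)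
    (hg : Function.Surjective g) {i : ℕ} (ζ : EX R X' C i) : EX R X'' C (i+1) :=
  (sc_se f g h hf hg).extClass.comp ζ (add_comm 1 i)

variable (f : X' →ₗ[R] X) (g : X →ₗ[R] X'') (h : Function.Exact f g) (hf : Function.Injective f)
    (hg : Function.Surjective g)

lemma dl_add {i : ℕ} (ζ η : EX R X' C i) : dl f g h hf hg (ζ + η) = dl f g h hf hg ζ + dl f g h hf hg η := by
  simp [dl]
@[simp] lemma dl_zero {i : ℕ} : dl f g h hf hg (0 : EX R X' C i) = 0 := by
  simp [dl]
lemma dl_smul {i : ℕ} (r : R) (ζ : EX R X' C i) : dl f g h hf hg (r • ζ) = r • dl f g h hf hg ζ := by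
  simp [dl]
lemma dl_sub {i : ℕ} (ζ η : EX R X' C i) : dl f g h hf hg (ζ - η) = dl f g h hf hg ζ - dl f g h hf hg η := by
  have := dl_add f g h hf hg (ζ - η) η
  rw [sub_add_cancel] at this
  rw [this, add_sub_cancel_right]

lemma pb_pb_zero (h : Function.Exact f g) {i : ℕ} (ξ : EX R X'' C i) : pb f (pb g ξ) = 0 := by
  rw [← pb_comp, show g ∘ₗ f = (0 : R) • (0 : X' →ₗ[R] X'') by
    ext x; simpa using h.apply_apply_eq_zero x]
  have : ModuleCat.ofHom ((0:R) • (0 : X' →ₗ[R] X'')) = 0 := by ext; simp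
  rw [pb, this]; simp

lemma dl_pb {i : ℕ} (ξ : EX R X C i) : dl f g h hf hg (pb f ξ) = 0 := by
  exact (sc_se f g h hf hg).extClass_comp_assoc ξ

lemma pb_dl {i : ℕ} (ζ : EX R X' C i) : pb g (dl f g h hf hg ζ) = 0 := by
  exact (sc_se f g h hf hg).comp_extClass_assoc ζ (add_comm 1 i)

lemma exact_mid (h : Function.Exact f g) (hf : Function.Injective f)
    (hg : Function.Surjective g) {i : ℕ} (ξ : EX R X C i) (h0 : pb f ξ = 0) : ∃ η : EX R X'' C i, pb g η = ξ :=
  Abelian.Ext.contravariant_sequence_exact₂ (sc_se f g h hf hg) _ ξ h0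

lemma exact_left {i : ℕ} (ζ : EX R X' C i) (h0 : dl f g h hf hg ζ = 0) : ∃ η : EX R X C i, pb f η = ζ :=
  Abelian.Ext.contravariant_sequence_exact₁ (sc_se f g h hf hg) _ ζ (add_comm 1 i) h0

lemma exact_right {i : ℕ} (ξ : EX R X'' C (i+1)) (h0 : pb g ξ = 0) :
    ∃ η : EX R X' C i, dl f g h hf hg η = ξ :=
  Abelian.Ext.contravariant_sequence_exact₃ (sc_se f g h hf hg) _ ξ h0 (add_comm 1 i)

lemma pb_inj0 (hg : Function.Surjective g) (ξ : EX R X'' C 0) (h0 : pb g ξ = 0) : ξ = 0 := by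
  obtain ⟨k, rfl⟩ := (Abelian.Ext.mk₀_bijective _ _).2 ξ
  rw [pb, Abelian.Ext.mk₀_comp_mk₀] at h0
  have : Epi (ModuleCat.ofHom g) := (ModuleCat.epi_iff_surjective _).2 hg
  rw [← Abelian.Ext.mk₀_zero] at h0 ⊢
  have := (Abelian.Ext.mk₀_bijective _ _).1 h0
  congr 1
  rw [← cancel_epi (ModuleCat.ofHom g), this]; simp

lemma dl_nat {Y' Y Y'' : Type} [AddCommGroup Y'] [Module R Y'] [AddCommGroup Y] [Module R Y]
    [AddCommGroup Y''] [Module R Y'']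
    (f₂ : Y' →ₗ[R] Y) (g₂ : Y →ₗ[R] Y'') (h₂ : Function.Exact f₂ g₂) (hf₂ : Function.Injective f₂)
    (hg₂ : Function.Surjective g₂) (a : Y' →ₗ[R] X') (b : Y →ₗ[R] X) (c : Y'' →ₗ[R] X'')
    (hab : f ∘ₗ a = b ∘ₗ f₂) (hbc : g ∘ₗ b = c ∘ₗ g₂) {i : ℕ} (ζ : EX R X' C i) :
    dl f₂ g₂ h₂ hf₂ hg₂ (pb a ζ) = pb c (dl f g h hf hg ζ) := by
  let φ : sc f₂ g₂ h₂ ⟶ sc f g h := ⟨ModuleCat.ofHom a, ModuleCat.ofHom b, ModuleCat.ofHom c,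
    by ext x; exact LinearMap.congr_fun hab x, by ext x; exact LinearMap.congr_fun hbc x⟩
  have := ShortComplex.ShortExact.extClass_naturality (sc_se f₂ g₂ h₂ hf₂ hg₂) (sc_se f g h hf hg) φ
  have h2 := congrArg (fun z => Abelian.Ext.comp z ζ (add_comm 1 i)) this
  simp only at h2
  rw [Abelian.Ext.comp_assoc _ _ _ (add_zero 1) (zero_add i) (by omega),
     Abelian.Ext.comp_assoc _ _ _ (zero_add 1) (add_comm 1 i) (by omega)] at h2
  exact h2

lemma EX_proj [Module.Projective R X] {i : ℕ} (ξ : EX R X C (i+1)) : ξ = 0 := by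
  have : Projective (ModuleCat.of R X) := inferInstance
  exact Abelian.Ext.eq_zero_of_projective ξ

/-- the degree zero class of a map -/
def e0 (k : X →ₗ[R] C) : EX R X C 0 := Abelian.Ext.mk₀ (ModuleCat.ofHom k)

lemma e0_surj (ξ : EX R X C 0) : ∃ k, e0 k = ξ := by
  obtain ⟨k, rfl⟩ := (Abelian.Ext.mk₀_bijective _ _).2 ξ
  exact ⟨k.hom, rfl⟩
lemma e0_inj {k l : X →ₗ[R] C} : e0 k = e0 l ↔ k = l := by
  constructor
  · intro h
    exact congrArg ModuleCat.Hom.hom ((Abelian.Ext.mk₀_bijective _ _).1 h)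
  · rintro rfl; rfl
lemma e0_eq_zero {k : X →ₗ[R] C} : e0 k = 0 ↔ k = 0 := by
  rw [← e0_inj]
  have : e0 (0 : X →ₗ[R] C) = 0 := Abelian.Ext.mk₀_zero _ _
  rw [this]
lemma pb_e0 (f : X →ₗ[R] Y) (k : Y →ₗ[R] C) : pb f (e0 k) = e0 (k ∘ₗ f) := by
  simp only [pb, e0, ModuleCat.ofHom_comp]
  rw [Abelian.Ext.mk₀_comp_mk₀]
lemma e0_smul (r : R) (k : X →ₗ[R] C) : e0 (r • k) = r • e0 k := by
  simp only [e0]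
  rw [← Abelian.Ext.mk₀_smul]; rfl
end Ext
end MaxDepthAux

namespace MaxDepthAux
open Opposite

section AR
variable {R : Type} [CommRing R]

lemma pb_factor {X Y C : Type} [AddCommGroup X] [Module R X] [AddCommGroup Y] [Module R Y]
    [AddCommGroup C] [Module R C] (a : X →ₗ[R] Y) (W : Submodule R Y) (ha : ∀ z, a z ∈ W) {i : ℕ}
    (η : EX R Y C i) (h : pb W.subtype η = 0) : pb a η = 0 := by
  rw [← pb_comp_eq (LinearMap.codRestrict _ a ha) W.subtype a rfl, h, pb_zero]

lemma dl_kill {F X F₂ X₂ C : Type} [AddCommGroup X] [Module R X] [AddCommGroup F] [Module R F]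
    [AddCommGroup F₂] [Module R F₂] [AddCommGroup X₂] [Module R X₂]
    [AddCommGroup C] [Module R C] (q : F →ₗ[R] X) (hq : Function.Surjective q)
    (q₂ : F₂ →ₗ[R] X₂) (hq₂ : Function.Surjective q₂) (b : F₂ →ₗ[R] F) (c : X₂ →ₗ[R] X)
    (hbc : q ∘ₗ b = c ∘ₗ q₂) (W : Submodule R (LinearMap.ker q))
    (hW : ∀ z, q₂ z = 0 → ∃ w ∈ W, w.1 = b z) {i : ℕ}
    (η : EX R (LinearMap.ker q) C i) (h : pb W.subtype η = 0) : 
    pb c (dl (LinearMap.ker q).subtype q (LinearMap.exact_subtype_ker_map q)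
      (Submodule.subtype_injective _) hq η) = 0 := by
  have hk : ∀ z : LinearMap.ker q₂, b z.1 ∈ LinearMap.ker q := fun z => by
    obtain ⟨w, _, hw⟩ := hW z.1 z.2
    rw [← hw]; exact w.2
  let a : LinearMap.ker q₂ →ₗ[R] LinearMap.ker q :=
      LinearMap.codRestrict _ (b ∘ₗ (Submodule.subtype _)) hk
  have ha0 : pb a η = 0 := by
    refine pb_factor a W (fun z => ?_) η h
    obtain ⟨w, hw, hw2⟩ := hW z.1 z.2
    have : a z = w := Subtype.ext hw2.symm
    rw [this]; exact hw
  rw [← dl_nat _ q _ (Submodule.subtype_injective _) hq (LinearMap.ker q₂).subtype q₂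
    (LinearMap.exact_subtype_ker_map q₂) (Submodule.subtype_injective _) hq₂ a b c rfl hbc η, ha0, dl_zero]

lemma artin_rees [IsNoetherianRing R] (G : Ideal R) {C : Type} [AddCommGroup C] [Module R C]
    (hG : ∀ g ∈ G, ∀ c : C, g • c = 0) (i : ℕ) :
    ∀ (X : Type) [AddCommGroup X] [Module R X] [Module.Finite R X] (ζ : EX R X C i),
    ∃ t, pb (G ^ t • (⊤ : Submodule R X)).subtype ζ = 0 := by
  induction i with
  | zero =>
    intro X _ _ _ ζ
    obtain ⟨k, rfl⟩ := e0_surj ζ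
    refine ⟨1, ?_⟩
    rw [pb_e0, e0_eq_zero]
    ext ⟨x, hx⟩
    simp only [LinearMap.coe_comp, Submodule.coe_subtype, Function.comp_apply, LinearMap.zero_apply]
    rw [pow_one] at hx
    induction hx using Submodule.smul_induction_on' with
    | smul r hr n hn => rw [map_smul, hG r hr]
    | add x hx y hy h1 h2 => rw [map_add, h1, h2, add_zero]
  | succ i ih =>
    intro X _ _ _ ζ
    obtain ⟨k, q, hq⟩ := Module.Finite.exists_fin' R X
    have hex : Function.Exact (LinearMap.ker q).subtype q := LinearMap.exact_subtype_ker_map q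
    obtain ⟨η, rfl⟩ := exact_right _ q hex (Submodule.subtype_injective _) hq ζ (EX_proj _)
    obtain ⟨t, ht⟩ := ih (LinearMap.ker q) η
    obtain ⟨c, hc⟩ := Ideal.exists_pow_inf_eq_pow_smul G (LinearMap.ker q)
    let n := t + c
    have hres : ∀ x ∈ (G ^ n • (⊤ : Submodule R (Fin k → R))), q x ∈ (G ^ n • (⊤ : Submodule R X)) := by
      intro x hx
      have : q x ∈ Submodule.map q (G ^ n • (⊤ : Submodule R (Fin k → R))) := ⟨x, hx, rfl⟩
      rw [Submodule.map_smul''] at this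
      exact (smul_mono_right _ le_top : _ ≤ G ^ n • (⊤ : Submodule R X)) this
    let q₂ := q.restrict hres
    have hq₂ : Function.Surjective q₂ := by
      rintro ⟨x, hx⟩
      have : x ∈ Submodule.map q (G ^ n • (⊤ : Submodule R (Fin k → R))) := by
        rw [Submodule.map_smul'', Submodule.map_top, LinearMap.range_eq_top.2 hq]; exact hx
      obtain ⟨y, hy, rfl⟩ := this
      exact ⟨⟨y, hy⟩, rfl⟩
    refine ⟨n, ?_⟩
    refine dl_kill q hq q₂ hq₂ (Submodule.subtype _) (Submodule.subtype _) rfl _ ?_ η ht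
    intro z hz
    have h1 : z.1 ∈ G ^ n • (⊤ : Submodule R (Fin k → R)) ⊓ LinearMap.ker q :=
      ⟨z.2, congrArg Subtype.val hz⟩
    rw [hc n (Nat.le_add_left _ _)] at h1
    have h2 : z.1 ∈ G ^ t • LinearMap.ker q := by
      have : n - c = t := Nat.add_sub_cancel _ _
      rw [this] at h1
      exact (smul_mono_right _ inf_le_right : _ ≤ G ^ t • LinearMap.ker q) h1
    have h3 : LinearMap.ker q = Submodule.map (LinearMap.ker q).subtype ⊤ := by simp
    rw [h3, ← Submodule.map_smul''] at h2
    exact h2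

end AR
end MaxDepthAux

namespace MaxDepthAux
open Opposite

section Kos
variable {R : Type} [CommRing R] {ι : Type} (w : ι → R)

/-- ideal generated by a list -/
def lI : List ι → Ideal R
  | [] => ⊥
  | a :: l => Ideal.span {w a} ⊔ lI l

/-- (reversed) regular sequences -/
def RegL : List ι → Prop
  | [] => True
  | a :: l => RegL l ∧ ∀ x, w a * x ∈ lI w l → x ∈ lI w l

lemma lI_le (a : ι) (l : List ι) : lI w l ≤ lI w (a :: l) := le_sup_right

/-- projection of quotients -/
def qp {I J : Ideal R} (h : J ≤ I) : (R ⧸ J) →ₗ[R] (R ⧸ I) := Submodule.mapQ J I LinearMap.id h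

lemma qp_mk {I J : Ideal R} (h : J ≤ I) (x : R) : qp h (Ideal.Quotient.mk J x) = Ideal.Quotient.mk I x := rfl

lemma qp_surj {I J : Ideal R} (h : J ≤ I) : Function.Surjective (qp h) := by
  intro x
  obtain ⟨x, rfl⟩ := Ideal.Quotient.mk_surjective x
  exact ⟨Ideal.Quotient.mk J x, rfl⟩

lemma qp_comp {I J K : Ideal R} (h : J ≤ I) (h' : K ≤ J) : qp h ∘ₗ qp h' = qp (h'.trans h) := by
  ext; rfl

lemma kos_exact (a : ι) (l : List ι) : 
    Function.Exact (w a • (LinearMap.id : (R ⧸ lI w l) →ₗ[R] _)) (qp (lI_le w a l)) := by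
  intro y
  obtain ⟨y, rfl⟩ := Ideal.Quotient.mk_surjective y
  rw [qp_mk, Ideal.Quotient.eq_zero_iff_mem]
  constructor
  · intro h
    obtain ⟨u, hu, v, hv, rfl⟩ := Submodule.mem_sup.1 h
    obtain ⟨z, rfl⟩ := Ideal.mem_span_singleton'.1 hu
    refine ⟨Ideal.Quotient.mk _ z, ?_⟩
    simp only [LinearMap.smul_apply, LinearMap.id_apply]
    change Ideal.Quotient.mk _ (w a * z) = _
    rw [Ideal.Quotient.eq]
    have : w a * z - (z * w a + v) = -v := by ring
    rw [this]; exact neg_mem hv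
  · rintro ⟨z, hw⟩
    obtain ⟨z, rfl⟩ := Ideal.Quotient.mk_surjective z
    have hw' : Ideal.Quotient.mk (lI w l) (w a * z) = Ideal.Quotient.mk _ y := hw
    rw [Ideal.Quotient.eq] at hw'
    have : y = w a * z - (w a * z - y) := by ring
    rw [this]
    exact sub_mem (Ideal.mem_sup_left (Ideal.mem_span_singleton'.2 ⟨z, by ring⟩)) (Ideal.mem_sup_right hw')

lemma kos_inj (a : ι) (l : List ι) (h : RegL w (a :: l)) :
    Function.Injective (w a • (LinearMap.id : (R ⧸ lI w l) →ₗ[R] _)) := by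
  rw [injective_iff_map_eq_zero]
  intro y
  obtain ⟨y, rfl⟩ := Ideal.Quotient.mk_surjective y
  intro hy
  rw [Ideal.Quotient.eq_zero_iff_mem]
  apply h.2
  rw [← Ideal.Quotient.eq_zero_iff_mem]
  exact hy

variable {C : Type} [AddCommGroup C] [Module R C]

lemma kos_vanish (l : List ι) : RegL w l → ∀ i, l.length < i → ∀ ξ : EX R (R ⧸ lI w l) C i, ξ = 0 := by
  induction l with
  | nil =>
    intro _ i hi ξ
    obtain ⟨i, rfl⟩ : ∃ j, i = j + 1 := ⟨i - 1, by simp at hi; omega⟩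
    have : Module.Projective R (R ⧸ lI w ([] : List ι)) :=
      Module.Projective.of_equiv (Submodule.quotEquivOfEqBot (⊥ : Ideal R) rfl).symm
    exact EX_proj ξ
  | cons a l ih =>
    intro h i hi ξ
    obtain ⟨i, rfl⟩ : ∃ j, i = j + 1 := ⟨i - 1, by simp at hi; omega⟩
    simp only [List.length_cons] at hi
    obtain ⟨η, rfl⟩ := exact_right _ _ (kos_exact w a l) (kos_inj w a l h) (qp_surj _) ξ
      (ih h.1 _ (by omega) _)
    rw [ih h.1 _ (by omega) η, dl_zero]

/-- Koszul class -/
def kap : (l : List ι) → RegL w l → C → EX R (R ⧸ lI w l) C l.length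
  | [], _, c => e0 (Submodule.liftQ _ (LinearMap.toSpanSingleton R C c) bot_le)
  | a :: l, h, c => dl _ _ (kos_exact w a l) (kos_inj w a l h) (qp_surj _) (kap l h.1 c)

lemma kap_smul (l : List ι) (h : RegL w l) (r : R) (c : C) : kap w l h (r • c) = r • kap w l h c := by
  induction l with
  | nil =>
    rw [kap, kap, ← e0_smul, e0_inj]
    ext; change (1:R) • (r • c) = r • ((1:R) • c); simp
  | cons a l ih =>
    rw [kap, kap, ih h.1, dl_smul]

lemma kap_sub (l : List ι) (h : RegL w l) (c c' : C) : kap w l h (c - c') = kap w l h c - kap w l h c' := by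
  induction l with
  | nil =>
    rw [kap, kap, kap, eq_sub_iff_add_eq, e0, e0, ← Abelian.Ext.mk₀_add, e0]
    congr 1
    ext; change (1:R) • (c - c') + (1:R) • c' = (1:R) • c; simp
  | cons a l ih =>
    rw [kap, kap, kap, ih h.1, dl_sub]

lemma kap_surj (l : List ι) (h : RegL w l) (ξ : EX R (R ⧸ lI w l) C l.length) : ∃ c : C, kap w l h c = ξ := by
  induction l with
  | nil =>
    obtain ⟨k, rfl⟩ := e0_surj ξ
    refine ⟨k (Ideal.Quotient.mk _ 1), ?_⟩
    rw [kap, e0_inj]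
    ext
    change (1:R) • k (Ideal.Quotient.mk _ 1) = k (Ideal.Quotient.mk _ 1); simp
  | cons a l ih =>
    obtain ⟨η, rfl⟩ := exact_right _ _ (kos_exact w a l) (kos_inj w a l h) (qp_surj _) ξ
      (kos_vanish w l h.1 _ (by simp) _)
    obtain ⟨c, rfl⟩ := ih h.1 η
    exact ⟨c, rfl⟩

lemma kap_zero (l : List ι) (h : RegL w l) (c : C) (h0 : kap w l h c = 0) :
    c ∈ lI w l • (⊤ : Submodule R C) := by
  induction l generalizing c with
  | nil =>
    rw [kap, e0_eq_zero] at h0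
    have := LinearMap.congr_fun h0 (Ideal.Quotient.mk _ 1)
    have h2 : (1:R) • c = 0 := this
    rw [one_smul] at h2
    rw [h2]; exact zero_mem _
  | cons a l ih =>
    obtain ⟨η, hη⟩ := exact_left _ _ (kos_exact w a l) (kos_inj w a l h) (qp_surj _) _ h0
    obtain ⟨c', rfl⟩ := kap_surj w l h.1 η
    rw [pb_lsmul, ← kap_smul] at hη
    have h3 : kap w l h.1 (c - w a • c') = 0 := by rw [kap_sub, hη, sub_self]
    have h4 := ih h.1 _ h3
    have : c = w a • c' + (c - w a • c') := by abel
    rw [this]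
    exact add_mem (Submodule.smul_mem_smul (Ideal.mem_sup_left (Ideal.mem_span_singleton_self (w a))) trivial)
      ((Submodule.smul_mono_left (lI_le w a l) : lI w l • (⊤ : Submodule R C) ≤ _) h4)

lemma lI_mono (w' b : ι → R) (hb : ∀ i, w' i = b i * w i) (T : List ι) : lI w' T ≤ lI w T := by
  induction T with
  | nil => exact le_rfl
  | cons i T ih =>
    refine sup_le_sup ?_ ih
    rw [Ideal.span_singleton_le_span_singleton, hb]
    exact Dvd.intro_left _ rfl

lemma kap_nat (w' b : ι → R) (hb : ∀ i, w' i = b i * w i) (T : List ι)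
    (h : RegL w T) (h' : RegL w' T) (hle : lI w' T ≤ lI w T) (c : C) :
    pb (qp hle) (kap w T h c) = kap w' T h' ((T.map b).prod • c) := by
  induction T with
  | nil => 
    simp only [List.map_nil, List.prod_nil, one_smul]
    rw [kap, kap, pb_e0, e0_inj]
    ext; rfl
  | cons i T ih =>
    have hle' : lI w' T ≤ lI w T := lI_mono w w' b hb T
    rw [kap, ← dl_nat _ _ (kos_exact w i T) (kos_inj w i T h) (qp_surj _) _ _ (kos_exact w' i T)
      (kos_inj w' i T h') (qp_surj _) (b i • qp hle') (qp hle') (qp hle)]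
    · rw [kap]
      congr 1
      have : (b i • qp hle') = (qp hle') ∘ₗ (b i • LinearMap.id) := by ext; rfl
      rw [this, pb_comp, ih h.1 h'.1 hle', pb_lsmul, ← kap_smul, List.map_cons, List.prod_cons, mul_smul]
    · ext
      change Ideal.Quotient.mk _ (w i * (b i * 1)) = Ideal.Quotient.mk _ (w' i * 1)
      rw [hb]; congr 1; ring
    · ext; rfl
end Kos
end MaxDepthAux

namespace MaxDepthAux
open Opposite

section CD
variable {R : Type} [CommRing R] {ι : Type}

lemma lI_le_iff (w : ι → R) (T : List ι) (J : Ideal R) : lI w T ≤ J ↔ ∀ i ∈ T, w i ∈ J := by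
  induction T with
  | nil => simp [lI]
  | cons a l ih => simp [lI, ih, Ideal.span_le]

lemma mem_smul_top_quot (I G : Ideal R) (s : ℕ) (x : R) (hx : x ∈ I ⊔ G ^ s) :
    Ideal.Quotient.mk I x ∈ G ^ s • (⊤ : Submodule R (R ⧸ I)) := by
  obtain ⟨u, hu, v, hv, rfl⟩ := Submodule.mem_sup.1 hx
  rw [map_add, Ideal.Quotient.eq_zero_iff_mem.2 hu, zero_add]
  have : Ideal.Quotient.mk I v = v • (Ideal.Quotient.mk I 1) := by
    rw [← mul_one v, map_mul, map_one]; simp [Algebra.smul_def]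
  rw [this]
  exact Submodule.smul_mem_smul hv trivial

lemma ker_smul (I G : Ideal R) (s u : ℕ) (z : R ⧸ I)
    (hz : qp (le_sup_left : I ≤ I ⊔ G ^ (u + s)) z = 0) :
    ∃ w ∈ G ^ u • (⊤ : Submodule R (LinearMap.ker (qp (le_sup_left : I ≤ I ⊔ G ^ s)))), w.1 = z := by
  obtain ⟨z, rfl⟩ := Ideal.Quotient.mk_surjective z
  rw [qp_mk, Ideal.Quotient.eq_zero_iff_mem] at hz
  have h1 : Ideal.Quotient.mk I z ∈ G ^ u • (LinearMap.ker (qp (le_sup_left : I ≤ I ⊔ G ^ s))) := by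
    have := mem_smul_top_quot I G _ z hz
    rw [pow_add, mul_smul] at this
    refine (smul_mono_right (G ^ u) (?_ : G ^ s • (⊤ : Submodule R (R ⧸ I)) ≤ _) : _ ≤ _) this
    rw [Submodule.smul_le]
    intro r hr x _
    obtain ⟨x, rfl⟩ := Ideal.Quotient.mk_surjective x
    rw [LinearMap.mem_ker, map_smul, qp_mk]
    change Ideal.Quotient.mk _ (r * x) = 0
    rw [Ideal.Quotient.eq_zero_iff_mem]
    exact Ideal.mem_sup_right (Ideal.mul_mem_right _ _ hr)
  have h3 : LinearMap.ker (qp (le_sup_left : I ≤ I ⊔ G ^ s)) = 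
    Submodule.map (LinearMap.ker (qp (le_sup_left : I ≤ I ⊔ G ^ s))).subtype ⊤ := by simp
  rw [h3, ← Submodule.map_smul''] at h1
  exact h1

theorem cd_eq [IsNoetherianRing R] (Q G : Ideal R) (C : Type) [AddCommGroup C] [Module R C]
    (hG : ∀ g ∈ G, ∀ c : C, g • c = 0) (θ : ι → R) (T : List ι)
    (hreg : ∀ t, RegL (fun i => θ i ^ t) T) (hθQ : ∀ i ∈ T, θ i ∈ Q) (hGQ : G ≤ Q)
    (hQ : ∀ t s, Q ≤ (lI (fun i => θ i ^ t) T ⊔ G ^ s).radical) (c0 : C) (t0 : ℕ)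
    (hc0 : ∀ k, (T.map (fun i => θ i ^ k)).prod • c0 ∉ lI (fun i => θ i ^ (t0 + k)) T • (⊤ : Submodule R C)) :
    cohDim R Q C = T.length := by
  let I : ℕ → Ideal R := fun t => lI (fun i => θ i ^ t) T
  have hIQ : ∀ t, I t ≤ Q ^ t := fun t => by
    rw [lI_le_iff]
    exact fun i hi => Ideal.pow_mem_pow (hθQ i hi) t
  have hcof : ∀ t s, ∃ u, ∀ v ≥ u, Q ^ v ≤ I t ⊔ G ^ s := fun t s => by
    obtain ⟨u, hu⟩ := Ideal.exists_pow_le_of_le_radical_of_fg (hQ t s) (IsNoetherian.noetherian _)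
    exact ⟨u, fun v hv => (Ideal.pow_le_pow_right hv).trans hu⟩
  rw [cohDim_eq]
  have hmem : ∃ (t : ℕ) (ξ : EX R (R ⧸ Q ^ t) C T.length), 
      ∀ (t' : ℕ) (h : t ≤ t'), pb (qp (Ideal.pow_le_pow_right (I := Q) h)) ξ ≠ 0 := by
    let κ : EX R (R ⧸ I t0) C T.length := kap _ T (hreg t0) c0
    obtain ⟨s, hs⟩ := artin_rees G hG _ (R ⧸ I t0) κ
    let q := qp (le_sup_left : I t0 ≤ I t0 ⊔ G ^ s)
    have hq : pb (LinearMap.ker q).subtype κ = 0 := by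
      refine pb_factor _ _ (fun z => ?_) κ hs
      obtain ⟨z, hz⟩ := z
      obtain ⟨z, rfl⟩ := Ideal.Quotient.mk_surjective z
      exact mem_smul_top_quot _ _ _ _ (Ideal.Quotient.eq_zero_iff_mem.1 hz)
    obtain ⟨ξ0, hξ0⟩ := exact_mid _ q (LinearMap.exact_subtype_ker_map q) 
      (Submodule.subtype_injective _) (qp_surj _) κ hq
    obtain ⟨t, ht⟩ := hcof t0 s
    refine ⟨t, pb (qp (ht t le_rfl)) ξ0, fun t' h h0 => ?_⟩
    have h1 : I (t0 + t') ≤ Q ^ t' := (hIQ _).trans (Ideal.pow_le_pow_right (by omega))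
    have hb : ∀ i, (fun i => θ i ^ (t0 + t')) i = (fun i => θ i ^ t') i * (fun i => θ i ^ t0) i := by
      intro i; simp only; ring
    have h2 : I (t0 + t') ≤ I t0 := lI_mono _ _ _ hb T
    have h3 : pb (qp h2) κ = 0 := by
      rw [← hξ0, ← pb_comp, qp_comp]
      rw [← pb_comp, qp_comp] at h0
      rw [← qp_comp ((Ideal.pow_le_pow_right h).trans (ht t le_rfl)) h1, pb_comp, h0, pb_zero]
    rw [kap_nat _ _ _ hb T (hreg t0) (hreg _) h2 c0] at h3
    exact hc0 t' (kap_zero _ _ _ _ h3)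
  have hub : ∀ i, T.length < i → ∀ (t : ℕ) (ξ : EX R (R ⧸ Q ^ t) C i), 
      ∃ (t' : ℕ) (h : t ≤ t'), pb (qp (Ideal.pow_le_pow_right (I := Q) h)) ξ = 0 := by
    intro i hi t ξ
    obtain ⟨i, rfl⟩ : ∃ j, i = j + 1 := ⟨i - 1, by omega⟩
    have hJ : I t ⊔ G ^ t ≤ Q ^ t := sup_le (hIQ t) (Ideal.pow_right_mono hGQ t)
    let q := qp (le_sup_left : I t ≤ I t ⊔ G ^ t)
    obtain ⟨η, hη⟩ := exact_right _ q (LinearMap.exact_subtype_ker_map q) 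
      (Submodule.subtype_injective _) (qp_surj _) (pb (qp hJ) ξ) (kos_vanish _ T (hreg t) _ hi _)
    obtain ⟨s0, hs0⟩ := artin_rees G hG _ _ η
    have hle : I t ⊔ G ^ (s0 + t) ≤ I t ⊔ G ^ t := sup_le_sup le_rfl (Ideal.pow_le_pow_right (by omega))
    have h1 := dl_kill q (qp_surj _) (qp (le_sup_left : I t ≤ I t ⊔ G ^ (s0 + t))) (qp_surj _)
      LinearMap.id (qp hle) (by rw [qp_comp]; rfl) _ (fun z hz => ker_smul _ _ _ _ z hz) η hs0
    rw [hη, ← pb_comp, qp_comp] at h1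
    obtain ⟨u, hu⟩ := hcof t (s0 + t)
    refine ⟨max u t, le_max_right _ _, ?_⟩
    rw [← qp_comp (hle.trans hJ) (hu _ (le_max_left _ _)), pb_comp, h1, pb_zero]
  refine le_antisymm (csSup_le (Set.nonempty_of_mem (x := T.length) hmem) ?_) ?_
  · rintro i ⟨t, ξ, h⟩
    by_contra hi
    obtain ⟨t', h', h0⟩ := hub i (by omega) t ξ
    exact h t' h' h0
  · refine le_csSup ⟨T.length, ?_⟩ hmem
    rintro i ⟨t, ξ, h⟩
    by_contra hi
    obtain ⟨t', h', h0⟩ := hub i (by omega) t ξ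
    exact h t' h' h0

end CD
end MaxDepthAux

namespace MaxDepthAux
open Opposite TensorProduct

section GR

section shift
variable {R : Type} [CommRing R]
variable {X X' X'' C : Type} [AddCommGroup X] [Module R X] [AddCommGroup X'] [Module R X']
  [AddCommGroup X''] [Module R X''] [AddCommGroup C] [Module R C]
  (f : X' →ₗ[R] X) (g : X →ₗ[R] X'') 
lemma shift1 (h : Function.Exact f g) (hf : Function.Injective f)
    (hg : Function.Surjective g) [Module.Projective R X] :
    (∀ ξ : EX R X'' C 1, ξ = 0) ↔ ∀ k : X' →ₗ[R] C, ∃ l : X →ₗ[R] C, l ∘ₗ f = k := by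
  constructor
  · intro H k
    obtain ⟨η, hη⟩ := exact_left f g h hf hg (e0 k) (H _)
    obtain ⟨l, rfl⟩ := e0_surj η
    rw [pb_e0, e0_inj] at hη
    exact ⟨l, hη⟩
  · intro H ξ
    obtain ⟨η, rfl⟩ := exact_right f g h hf hg ξ (EX_proj _)
    obtain ⟨k, rfl⟩ := e0_surj η
    obtain ⟨l, rfl⟩ := H k
    rw [← pb_e0, dl_pb]

lemma shift2 (h : Function.Exact f g) (hf : Function.Injective f)
    (hg : Function.Surjective g) [Module.Projective R X] (i : ℕ) :
    (∀ ξ : EX R X'' C (i+2), ξ = 0) ↔ ∀ ξ : EX R X' C (i+1), ξ = 0 := by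
  constructor
  · intro H ξ
    obtain ⟨η, rfl⟩ := exact_left f g h hf hg ξ (H _)
    rw [EX_proj η, pb_zero]
  · intro H ξ
    obtain ⟨η, rfl⟩ := exact_right f g h hf hg ξ (EX_proj _)
    rw [H η, dl_zero]

lemma EX_equiv (e : X ≃ₗ[R] X') (i : ℕ) (H : ∀ ξ : EX R X C i, ξ = 0) : ∀ ξ : EX R X' C i, ξ = 0 := by
  intro ξ
  rw [← pb_id ξ, ← pb_comp_eq e.symm.toLinearMap e.toLinearMap _ (by ext; simp), H (pb _ ξ), pb_zero]
end shift

variable {A S : Type} [CommRing A] [CommRing S] [Algebra A S] 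
  {M N B : Type} [AddCommGroup M] [Module S M] [Module A M] [IsScalarTower A S M] 
  [AddCommGroup N] [Module A N] 

lemma ext_flat [IsNoetherianRing A] [Module.Flat A S] [Nonempty B] (e : M ≃ₗ[A] (B →₀ N)) (i : ℕ) :
    ∀ (X : Type) [AddCommGroup X] [Module A X] [Module.Finite A X],
    (∀ ξ : EX S (S ⊗[A] X) M i, ξ = 0) ↔ ∀ ξ : EX A X N i, ξ = 0 := by
  obtain ⟨b0⟩ := ‹Nonempty B›
  match i with
  | 0 =>
    intro X _ _ _
    constructor
    · intro H ξ
      obtain ⟨k, rfl⟩ := e0_surj ξ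
      rw [e0_eq_zero]
      let k' : X →ₗ[A] M := e.symm.toLinearMap ∘ₗ (Finsupp.lsingle b0) ∘ₗ k
      have h1 := H (e0 (LinearMap.liftBaseChange S k'))
      rw [e0_eq_zero] at h1
      ext x
      have h2 := LinearMap.congr_fun h1 (1 ⊗ₜ x)
      simp only [LinearMap.liftBaseChange_tmul, one_smul, LinearMap.zero_apply] at h2
      simpa [k'] using h2
    · intro H ξ
      obtain ⟨k, rfl⟩ := e0_surj ξ
      rw [e0_eq_zero]
      apply TensorProduct.AlgebraTensorModule.curry_injective
      ext x
      simp only [TensorProduct.AlgebraTensorModule.curry_apply,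
        TensorProduct.curry_apply]
      apply e.injective
      change e (k (1 ⊗ₜ[A] x)) = e 0
      rw [LinearEquiv.map_zero]
      ext b
      let k' : X →ₗ[A] N := Finsupp.lapply b ∘ₗ e.toLinearMap ∘ₗ (k.restrictScalars A) ∘ₗ (TensorProduct.mk A S X 1)
      have h1 := H (e0 k')
      rw [e0_eq_zero] at h1
      have h2 := LinearMap.congr_fun h1 x
      simpa [k'] using h2
  | 1 =>
    intro X _ _ _
    obtain ⟨n, q, hq⟩ := Module.Finite.exists_fin' A X
    have hex : Function.Exact (LinearMap.ker q).subtype q := LinearMap.exact_subtype_ker_map q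
    rw [shift1 _ q hex (Submodule.subtype_injective _) hq,
      shift1 ((LinearMap.ker q).subtype.baseChange S) (q.baseChange S) 
        (lTensor_exact S hex hq)
        (Module.Flat.lTensor_preserves_injective_linearMap _ (Submodule.subtype_injective _)) 
        (LinearMap.lTensor_surjective S hq)]
    constructor
    · intro H k
      let k' : LinearMap.ker q →ₗ[A] M := e.symm.toLinearMap ∘ₗ (Finsupp.lsingle b0) ∘ₗ k
      obtain ⟨l, hl⟩ := H (LinearMap.liftBaseChange S k')
      refine ⟨Finsupp.lapply b0 ∘ₗ e.toLinearMap ∘ₗ (l.restrictScalars A) ∘ₗ (TensorProduct.mk A S _ 1), ?_⟩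
      ext x
      have h2 := LinearMap.congr_fun hl (1 ⊗ₜ x)
      simp [k'] at h2
      simp [h2]
    · intro H k
      let k' : LinearMap.ker q →ₗ[A] (B →₀ N) := 
        e.toLinearMap ∘ₗ (k.restrictScalars A) ∘ₗ (TensorProduct.mk A S _ 1)
      have hfs : ∃ s : Finset B, ∀ x, ∀ b ∉ s, k' x b = 0 := by
        classical
        obtain ⟨t, ht⟩ := (inferInstance : Module.Finite A (LinearMap.ker q)).fg_top
        refine ⟨t.biUnion (fun x => (k' x).support), fun x b hb => ?_⟩
        have : x ∈ Submodule.span A (t : Set (LinearMap.ker q)) := ht ▸ trivial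
        induction this using Submodule.span_induction with
        | mem x hx =>
          by_contra h
          exact hb (Finset.mem_biUnion.2 ⟨x, hx, by simpa using h⟩)
        | zero => simp
        | add x y _ _ h1 h2 => simp [h1, h2]
        | smul a x _ h => simp [h]
      obtain ⟨s, hs⟩ := hfs
      choose l hl using fun b : B => H (Finsupp.lapply b ∘ₗ k')
      let l' : (Fin n → A) →ₗ[A] (B →₀ N) := ∑ b ∈ s, Finsupp.lsingle b ∘ₗ l b
      have hl' : l' ∘ₗ (LinearMap.ker q).subtype = k' := by
        ext x b
        have h3 : ∀ b', l b' x.1 = k' x b' := fun b' => LinearMap.congr_fun (hl b') x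
        have h4 : l' x.1 = ∑ b' ∈ s, Finsupp.single b' (k' x b') := by
          simp [l', LinearMap.sum_apply, h3]
        change l' x.1 b = k' x b
        classical
        rw [h4, Finsupp.finsetSum_apply]
        simp only [Finsupp.single_apply, Finset.sum_ite_eq']
        by_cases hb : b ∈ s
        · simp [hb]
        · simp [hb, hs x b hb]
      refine ⟨LinearMap.liftBaseChange S (e.symm.toLinearMap ∘ₗ l'), ?_⟩
      apply TensorProduct.AlgebraTensorModule.curry_injective
      ext x
      have := LinearMap.congr_fun hl' x
      have h5 : l' x.1 = e (k (1 ⊗ₜ[A] x)) := this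
      simp [h5]
  | (i+2) =>
    intro X _ _ _
    obtain ⟨n, q, hq⟩ := Module.Finite.exists_fin' A X
    have hex : Function.Exact (LinearMap.ker q).subtype q := LinearMap.exact_subtype_ker_map q
    rw [shift2 _ q hex (Submodule.subtype_injective _) hq,
      shift2 ((LinearMap.ker q).subtype.baseChange S) (q.baseChange S) 
        (lTensor_exact S hex hq)
        (Module.Flat.lTensor_preserves_injective_linearMap _ (Submodule.subtype_injective _)) 
        (LinearMap.lTensor_surjective S hq)]
    exact ext_flat e (i+1) _

lemma grade_eq [IsNoetherianRing A] [Module.Flat A S] [Nonempty B] (e : M ≃ₗ[A] (B →₀ N)) (I : Ideal A)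
    (J : Ideal S) (hJ : J = I.map (algebraMap A S)) :
    extGrade S J M = extGrade A I N := by
  subst hJ
  rw [extGrade_eq, extGrade_eq]
  congr 1
  ext i
  simp only [Set.mem_ofPred_eq]
  rw [← not_iff_not]
  push Not
  rw [← ext_flat (S := S) e i (A ⧸ I)]
  let E : (S ⊗[A] (A ⧸ I)) ≃ₗ[S] (S ⧸ I.map (algebraMap A S)) :=
    (Algebra.TensorProduct.quotIdealMapEquivTensorQuot S I).symm.toLinearEquiv
  exact ⟨EX_equiv E.symm i, EX_equiv E i⟩
end GR
end MaxDepthAux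

namespace MaxDepthAux

section Ass

lemma ass_iff {R : Type} [CommRing R] [IsNoetherianRing R] {V : Type} [AddCommGroup V] [Module R V] (P : Ideal R) :
    P ∈ associatedPrimes R V ↔ P.IsPrime ∧ ∃ x : V, ∀ r, r ∈ P ↔ r • x = 0 := by
  rw [AssociatedPrimes.mem_iff, isAssociatedPrime_iff]
  simp [SetLike.ext_iff, Submodule.mem_colon_singleton]

lemma core {R : Type} [CommRing R] {V : Type} [AddCommGroup V] [Module R V] (P : Ideal R) [P.IsPrime]
    (w : V) (hP : ∀ r, r ∈ P ↔ r • w = 0) (c : ℕ → V) (r : ℕ) (hw : w = ∑ k ∈ Finset.range r, c k)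
    (h : R) (hh : ∀ k, h • c k ∈ Submodule.span R {v | ∃ j < k, v = c j}) : h ∈ P := by
  have key : ∀ k, ∀ v ∈ Submodule.span R {v | ∃ j < k, v = c j}, h ^ k • v = 0 := by
    intro k
    induction k with
    | zero => intro v hv; simpa using hv
    | succ k ih =>
      intro v hv
      induction hv using Submodule.span_induction with
      | mem v hv =>
        obtain ⟨j, hj, rfl⟩ := hv
        rcases Nat.lt_succ_iff_lt_or_eq.1 hj with hj | rfl
        · rw [pow_succ', mul_smul, ih _ (Submodule.subset_span ⟨j, hj, rfl⟩), smul_zero]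
        · rw [pow_succ, mul_smul, ih _ (hh j)]
      | zero => simp
      | add x y _ _ h1 h2 => rw [smul_add, h1, h2, add_zero]
      | smul a x _ h1 => rw [smul_comm, h1, smul_zero]
  have : h ^ r ∈ P := by
    rw [hP, hw]
    apply key
    exact Submodule.sum_mem _ fun k hk => Submodule.subset_span ⟨k, Finset.mem_range.1 hk, rfl⟩
  exact Ideal.IsPrime.mem_of_pow_mem inferInstance _ this

lemma grading_proj {K σ L : Type} [Field K] [AddCommGroup L] [Module (MvPolynomial σ K) L]
    (ℒ : ℕ → AddSubgroup L) (hL : IsMvGrading K σ L ℒ) :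
    ∃ π : ℕ → L →+ L, (∀ x, ∃ r, ∀ r' ≥ r, x = ∑ k ∈ Finset.range r', π k x) ∧
      (∀ x k, π k x ∈ ℒ k) ∧
      ∀ (d k : ℕ) (φ : MvPolynomial σ K) (x : L), φ.IsHomogeneous d →
        π k (φ • x) = if d ≤ k then φ • π (k - d) x else 0 := by
  classical
  let _ : DirectSum.Decomposition ℒ := hL.internal.chooseDecomposition
  let π : ℕ → L →+ L := fun k => 
    { toFun := fun x => (DirectSum.decompose ℒ x k : L)
      map_zero' := by simp
      map_add' := by simp }
  have hmem : ∀ x k, π k x ∈ ℒ k := fun x k => (DirectSum.decompose ℒ x k).2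
  have hsum : ∀ x, ∃ r, ∀ r' ≥ r, x = ∑ k ∈ Finset.range r', π k x := by
    intro x
    let s := (DirectSum.decompose ℒ x).support
    refine ⟨s.sup id + 1, fun r' hr' => ?_⟩
    conv_lhs => rw [← DirectSum.sum_support_decompose ℒ x]
    apply Finset.sum_subset
    · intro k hk
      rw [Finset.mem_range]
      exact lt_of_lt_of_le (Nat.lt_succ_of_le (Finset.le_sup (f := id) hk)) hr'
    · intro k _ hk
      rw [DFinsupp.notMem_support_iff] at hk
      rw [hk]; rfl
  refine ⟨π, hsum, hmem, ?_⟩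
  intro d k φ x hφ
  have hsame : ∀ y i, y ∈ ℒ i → ∀ k, π k y = if i = k then y else 0 := by
    intro y i hy k
    split_ifs with h
    · subst h; exact DirectSum.decompose_of_mem_same ℒ hy
    · exact DirectSum.decompose_of_mem_ne ℒ hy h
  obtain ⟨r, hr⟩ := hsum x
  replace hr := hr r le_rfl
  have h1 : ∀ k, π k (φ • x) = ∑ j ∈ Finset.range r, if d + j = k then φ • π j x else 0 := by
    intro k
    conv_lhs => rw [hr, Finset.smul_sum, map_sum]
    exact Finset.sum_congr rfl fun j _ => hsame _ _ (hL.smul_mem d j φ _ hφ (hmem x j)) k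
  have h2 : ∀ j, j ∉ Finset.range r → π j x = 0 := by
    intro j hj
    have : π j x = ∑ i ∈ Finset.range r, if i = j then π i x else 0 := by
      conv_lhs => rw [hr, map_sum]
      exact Finset.sum_congr rfl fun i _ => hsame _ _ (hmem x i) j
    rw [this, Finset.sum_ite_eq']; simp [hj]
  rw [h1]
  split_ifs with h
  · obtain ⟨j, rfl⟩ := Nat.exists_eq_add_of_le h
    simp only [add_right_inj, add_tsub_cancel_left, Finset.sum_ite_eq']
    split_ifs with h3
    · rfl
    · rw [h2 j h3, smul_zero]
  · apply Finset.sum_eq_zero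
    intro j _
    rw [if_neg]; omega

/-- associated primes of graded modules are homogeneous -/
lemma ass_homog {K σ N : Type} [Field K] [Finite σ] [AddCommGroup N] [Module (MvPolynomial σ K) N]
    (𝒩 : ℕ → AddSubgroup N) (hN : IsMvGrading K σ N 𝒩) (p : Ideal (MvPolynomial σ K))
    (hp : p ∈ associatedPrimes (MvPolynomial σ K) N) (f : MvPolynomial σ K) (hf : f ∈ p) (i : ℕ) :
    homogeneousComponent i f ∈ p := by
  obtain ⟨π, hsum, hmem, hsm⟩ := grading_proj 𝒩 hN
  rw [ass_iff] at hp
  obtain ⟨hpp, w, hw⟩ := hp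
  obtain ⟨r, hr⟩ := hsum w
  replace hr := hr r le_rfl
  induction i using Nat.strong_induction_on with
  | _ i ih =>
  refine core p w hw (fun k => π k w) r hr _ ?_
  intro k
  have h1 : π (i + k) (f • w) = 0 := by rw [(hw f).1 hf, map_zero]
  have h2 : f • w = ∑ j ∈ Finset.range (f.totalDegree + 1 + i), homogeneousComponent j f • w := by
    rw [← Finset.sum_smul]
    congr 1
    conv_lhs => rw [← sum_homogeneousComponent f]
    apply Finset.sum_subset
    · intro j; simp only [Finset.mem_range]; omega
    · intro j _ hj
      apply homogeneousComponent_eq_zero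
      simp at hj; omega
  rw [h2, map_sum, Finset.sum_congr rfl fun j _ => hsm j (i+k) _ w (homogeneousComponent_isHomogeneous j f),
    ← Finset.add_sum_erase _ _ (a := i) (by simp)] at h1
  simp only [le_add_iff_nonneg_right, zero_le, if_true, add_tsub_cancel_left] at h1
  rw [eq_neg_of_add_eq_zero_left h1]
  apply neg_mem
  apply Submodule.sum_mem
  intro j hj
  simp only [Finset.mem_erase] at hj
  rcases lt_or_gt_of_ne hj.1 with hji | hji
  · rw [if_pos (by omega)]
    have h3 := (hw _).1 (ih j hji)
    have h4 : π (i + k) (homogeneousComponent j f • w) = 0 := by rw [h3, map_zero]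
    rw [hsm j _ _ w (homogeneousComponent_isHomogeneous j f), if_pos (by omega)] at h4
    rw [h4]; exact zero_mem _
  · split_ifs with h5
    · exact Submodule.smul_mem _ _ (Submodule.subset_span ⟨i + k - j, by omega, rfl⟩)
    · exact zero_mem _
end Ass
end MaxDepthAux

namespace MaxDepthAux
open TensorProduct
section AssM

lemma ass_finsupp {A N B : Type} [CommRing A] [IsNoetherianRing A] [AddCommGroup N] [Module A N]
    (p : Ideal A) (hp : p.IsPrime) (y : B →₀ N) (hy : ∀ r, r ∈ p ↔ r • y = 0) :
    p ∈ associatedPrimes A N := by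
  classical
  have h1 : (y.support.inf fun b => LinearMap.ker (LinearMap.toSpanSingleton A N (y b))) ≤ p := by
    intro r hr
    rw [hy]
    ext b
    rw [Submodule.mem_finsetInf] at hr
    by_cases hb : b ∈ y.support
    · have := hr b hb
      simpa using this
    · simp [Finsupp.notMem_support_iff.1 hb]
  obtain ⟨b, hb, hle⟩ := (Ideal.IsPrime.inf_le' hp).1 h1
  rw [ass_iff]
  refine ⟨hp, y b, fun r => ⟨fun hr => ?_, fun hr => ?_⟩⟩
  · have := DFunLike.congr_fun ((hy r).1 hr) b
    simpa using this
  · apply hle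
    simpa using hr

variable {K : Type} [Field K] {m n : ℕ}
    {L : Type} [AddCommGroup L] [Module K L] [Module (MvPolynomial (Fin m) K) L]
    [IsScalarTower K (MvPolynomial (Fin m) K) L]
    {N : Type} [AddCommGroup N] [Module K N] [Module (MvPolynomial (Fin n) K) N]
    [IsScalarTower K (MvPolynomial (Fin n) K) N]
    {M : Type} [AddCommGroup M] [Module K M] [Module (BGS K m n) M]
    [IsScalarTower K (BGS K m n) M]
    (e : M ≃ₗ[K] L ⊗[K] N)

/-- inclusion K[y] → S -/
abbrev iy (K : Type) [Field K] (m n : ℕ) : MvPolynomial (Fin n) K →ₐ[K] BGS K m n := rename Sum.inr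

/-- x = 0 -/
abbrev ev0 (K : Type) [Field K] (m n : ℕ) : BGS K m n →ₐ[K] MvPolynomial (Fin n) K :=
  aeval (Sum.elim (fun _ => 0) X)

lemma ev0_iy (a : MvPolynomial (Fin n) K) : ev0 K m n (iy K m n a) = a := by
  rw [ev0, iy, aeval_rename]
  exact aeval_X_left_apply a

lemma C_smul' {σ V : Type} [AddCommGroup V] [Module K V] [Module (MvPolynomial σ K) V]
    [IsScalarTower K (MvPolynomial σ K) V] (c : K) (v : V) : (C c : MvPolynomial σ K) • v = c • v := by
  rw [← MvPolynomial.algebraMap_eq, algebraMap_smul]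

lemma act_y (hy : ∀ (j : Fin n) (u : L) (v : N),
      e ((X (Sum.inr j) : BGS K m n) • e.symm (u ⊗ₜ[K] v))
        = u ⊗ₜ[K] ((X j : MvPolynomial (Fin n) K) • v)) (a : MvPolynomial (Fin n) K) :
    ∀ (u : L) (v : N), e (iy K m n a • e.symm (u ⊗ₜ[K] v)) = u ⊗ₜ[K] (a • v) := by
  induction a using MvPolynomial.induction_on with
  | C c => 
    intro u v
    rw [iy, rename_C, C_smul', C_smul', map_smul, e.apply_symm_apply, TensorProduct.tmul_smul]
  | add p q hp hq => 
    intro u v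
    rw [map_add, add_smul, map_add, hp, hq, add_smul, TensorProduct.tmul_add]
  | mul_X p j hp => 
    intro u v
    have : (X (Sum.inr j) : BGS K m n) • e.symm (u ⊗ₜ[K] v) = e.symm (u ⊗ₜ[K] ((X j : MvPolynomial (Fin n) K) • v)) := by
      rw [← hy, e.symm_apply_apply]
    rw [map_mul, mul_smul, iy, rename_X, this, hp, mul_smul]

open Classical in
/-- coordinates -/
def Eq0 {β : Type} (b : Module.Basis β K L) : M ≃ₗ[K] (β →₀ N) :=
  e.trans (TensorProduct.equivFinsuppOfBasisLeft b)

lemma Eq0_apply {β : Type} (b : Module.Basis β K L) (u : L) (v : N) (i : β) :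
    Eq0 e b (e.symm (u ⊗ₜ v)) i = b.repr u i • v := by
  simp [Eq0]

lemma M_ind (p : M → Prop) (h : ∀ u v, p (e.symm (u ⊗ₜ v))) (hadd : ∀ x y, p x → p y → p (x + y))
    (h0 : p 0) (w : M) : p w := by
  rw [← e.symm_apply_apply w]
  induction e w using TensorProduct.induction_on with
  | zero => simpa using h0
  | tmul u v => exact h u v
  | add x y hx hy => rw [map_add]; exact hadd _ _ hx hy

lemma Eq0_smul (hy : ∀ (j : Fin n) (u : L) (v : N),
      e ((X (Sum.inr j) : BGS K m n) • e.symm (u ⊗ₜ[K] v))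
        = u ⊗ₜ[K] ((X j : MvPolynomial (Fin n) K) • v)) {β : Type} (b : Module.Basis β K L)
    (a : MvPolynomial (Fin n) K) (w : M) : Eq0 e b (iy K m n a • w) = a • Eq0 e b w := by
  induction w using M_ind e with
  | h u v =>
    ext i
    have := act_y e hy a u v
    rw [← LinearEquiv.eq_symm_apply] at this
    rw [this, Eq0_apply, Finsupp.smul_apply, Eq0_apply, smul_comm]
  | hadd x y hx hy => rw [smul_add, map_add, hx, hy, map_add, smul_add]
  | h0 => simp

lemma ass_down (hy : ∀ (j : Fin n) (u : L) (v : N),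
      e ((X (Sum.inr j) : BGS K m n) • e.symm (u ⊗ₜ[K] v))
        = u ⊗ₜ[K] ((X j : MvPolynomial (Fin n) K) • v)) (P : Ideal (BGS K m n))
    (hP : P ∈ associatedPrimes (BGS K m n) M) :
    P.comap (iy K m n) ∈ associatedPrimes (MvPolynomial (Fin n) K) N := by
  rw [ass_iff] at hP
  obtain ⟨hpp, w, hw⟩ := hP
  refine ass_finsupp _ (Ideal.IsPrime.comap _) (Eq0 e (Module.Basis.ofVectorSpace K L) w) fun r => ?_
  rw [Ideal.mem_comap, hw, ← Eq0_smul e hy, LinearEquiv.map_eq_zero_iff]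

lemma ass_up [Nontrivial L] (hx : ∀ (i : Fin m) (u : L) (v : N),
      e ((X (Sum.inl i) : BGS K m n) • e.symm (u ⊗ₜ[K] v))
        = ((X i : MvPolynomial (Fin m) K) • u) ⊗ₜ[K] v)
    (hy : ∀ (j : Fin n) (u : L) (v : N),
      e ((X (Sum.inr j) : BGS K m n) • e.symm (u ⊗ₜ[K] v))
        = u ⊗ₜ[K] ((X j : MvPolynomial (Fin n) K) • v)) (p : Ideal (MvPolynomial (Fin n) K))
    (hp : p ∈ associatedPrimes (MvPolynomial (Fin n) K) N) :
    ∃ P ∈ associatedPrimes (BGS K m n) M, P.comap (iy K m n) = p := by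
  classical
  rw [ass_iff] at hp
  obtain ⟨hpp, v, hv⟩ := hp
  have hv0 : v ≠ 0 := by
    intro h
    exact hpp.ne_top (Ideal.eq_top_iff_one _ |>.2 ((hv 1).2 (by simp [h])))
  let b := Module.Basis.ofVectorSpace K L
  let W : AddSubgroup M := AddSubgroup.closure {w | ∃ (u : L) (a : MvPolynomial (Fin n) K), w = e.symm (u ⊗ₜ (a • v))}
  have hWs : ∀ s : BGS K m n, ∀ w ∈ W, s • w ∈ W := by
    intro s
    induction s using MvPolynomial.induction_on with
    | C c =>
      intro w hw
      rw [C_smul']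
      induction hw using AddSubgroup.closure_induction with
      | mem w hw =>
        obtain ⟨u, a, rfl⟩ := hw
        apply AddSubgroup.subset_closure
        exact ⟨c • u, a, by rw [← map_smul, TensorProduct.smul_tmul']⟩
      | zero => simp
      | add x y _ _ h1 h2 => rw [smul_add]; exact add_mem h1 h2
      | neg x _ h1 => rw [smul_neg]; exact neg_mem h1
    | add p q hp hq => intro w hw; rw [add_smul]; exact add_mem (hp w hw) (hq w hw)
    | mul_X p j hp =>
      intro w hw
      rw [mul_smul]
      apply hp
      induction hw using AddSubgroup.closure_induction with
      | mem w hw =>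
        obtain ⟨u, a, rfl⟩ := hw
        apply AddSubgroup.subset_closure
        rcases j with i | j
        · refine ⟨(X i : MvPolynomial (Fin m) K) • u, a, ?_⟩
          rw [← hx, e.symm_apply_apply]
        · refine ⟨u, X j * a, ?_⟩
          rw [mul_smul, ← hy, e.symm_apply_apply]
      | zero => simp
      | add x y _ _ h1 h2 => rw [smul_add]; exact add_mem h1 h2
      | neg x _ h1 => rw [smul_neg]; exact neg_mem h1
  let U : Submodule (BGS K m n) M := { W with smul_mem' := fun s w hw => hWs s w hw }
  have hU : ∀ w ∈ U, ∀ i, ∃ a : MvPolynomial (Fin n) K, Eq0 e b w i = a • v := by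
    intro w hw i
    have hw' : w ∈ W := hw
    clear hw
    induction hw' using AddSubgroup.closure_induction with
    | mem w hw =>
      obtain ⟨u, a, rfl⟩ := hw
      rw [Eq0_apply]
      exact ⟨b.repr u i • a, by rw [smul_assoc]⟩
    | zero => exact ⟨0, by simp⟩
    | add x y h1 h2 h3 h4 =>
      obtain ⟨a, ha⟩ := h3
      obtain ⟨a', ha'⟩ := h4
      exact ⟨a + a', by rw [map_add, Finsupp.add_apply, ha, ha', add_smul]⟩
    | neg x h1 h2 =>
      obtain ⟨a, ha⟩ := h2
      exact ⟨-a, by rw [map_neg, Finsupp.neg_apply, ha, neg_smul]⟩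
  obtain ⟨u, hu⟩ := exists_ne (0 : L)
  have : Nontrivial U := by
    refine ⟨⟨⟨e.symm (u ⊗ₜ v), AddSubgroup.subset_closure ⟨u, 1, by simp⟩⟩, 0, ?_⟩⟩
    intro h
    have h1 : e.symm (u ⊗ₜ[K] v) = 0 := congrArg Subtype.val h
    have h2 : b.repr u ≠ 0 := by simpa using hu
    obtain ⟨i, hi⟩ := Finsupp.ne_iff.1 h2
    have h3 := Eq0_apply e b u v i
    rw [h1] at h3
    rw [map_zero, Finsupp.zero_apply] at h3
    rcases smul_eq_zero.1 h3.symm with h3 | h3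
    · exact hi (by simpa using h3)
    · exact hv0 h3
  obtain ⟨P, hP⟩ := associatedPrimes.nonempty (BGS K m n) U
  have hPM : P ∈ associatedPrimes (BGS K m n) M := associatedPrimes.subset_of_injective (f := U.subtype) U.injective_subtype hP
  refine ⟨P, hPM, ?_⟩
  rw [ass_iff] at hP
  obtain ⟨hPP, w, hw⟩ := hP
  have hw0 : (w : M) ≠ 0 := by
    intro h
    have : w = 0 := Subtype.ext h
    exact hPP.ne_top (Ideal.eq_top_iff_one _ |>.2 ((hw 1).2 (by simp [this])))
  ext r
  have hr1 : r ∈ P.comap (iy K m n) ↔ ∀ i, r • Eq0 e b w i = 0 := by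
    rw [Ideal.mem_comap, hw]
    have : iy K m n r • w = 0 ↔ iy K m n r • (w : M) = 0 := by
      rw [← Submodule.coe_smul]; exact (Submodule.coe_eq_zero).symm
    rw [this, ← LinearEquiv.map_eq_zero_iff (Eq0 e b), Eq0_smul e hy, Finsupp.ext_iff]
    simp
  rw [hr1]
  constructor
  · intro h
    have h2 : Eq0 e b w ≠ 0 := by simpa using hw0
    obtain ⟨i, hi⟩ := Finsupp.ne_iff.1 h2
    obtain ⟨a, ha⟩ := hU w w.2 i
    have h3 := h i
    rw [ha, ← mul_smul, ← hv] at h3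
    refine (hpp.mem_or_mem h3).resolve_right fun h4 => hi ?_
    rw [ha, (hv a).1 h4]; rfl
  · intro h i
    obtain ⟨a, ha⟩ := hU w w.2 i
    rw [ha, smul_comm, (hv r).1 h, smul_zero]

lemma ass_ev0 (ℒ : ℕ → AddSubgroup L) (hL : IsMvGrading K (Fin m) L ℒ) (hx : ∀ (i : Fin m) (u : L) (v : N),
      e ((X (Sum.inl i) : BGS K m n) • e.symm (u ⊗ₜ[K] v))
        = ((X i : MvPolynomial (Fin m) K) • u) ⊗ₜ[K] v)
    (hy : ∀ (j : Fin n) (u : L) (v : N),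
      e ((X (Sum.inr j) : BGS K m n) • e.symm (u ⊗ₜ[K] v))
        = u ⊗ₜ[K] ((X j : MvPolynomial (Fin n) K) • v)) (P : Ideal (BGS K m n))
    (hP : P ∈ associatedPrimes (BGS K m n) M) (h : BGS K m n) (hhP : h ∈ P) :
    ev0 K m n h ∈ P.comap (iy K m n) := by
  obtain ⟨π, hsum, hmem, hsm⟩ := grading_proj ℒ hL
  rw [ass_iff] at hP
  obtain ⟨hpp, w, hw⟩ := hP
  let πl : ℕ → L →ₗ[K] L := fun k =>
    { π k with
      map_smul' := by
        intro c x
        have := hsm 0 k (C c) x (isHomogeneous_C _ _)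
        simp only [C_smul', Nat.zero_le, if_true, Nat.sub_zero] at this
        exact this }
  let E : ℕ → M →ₗ[K] M := fun k => e.symm.toLinearMap ∘ₗ (LinearMap.rTensor N (πl k)) ∘ₗ e.toLinearMap
  have hE : ∀ k u v, E k (e.symm (u ⊗ₜ v)) = e.symm (π k u ⊗ₜ v) := by
    intro k u v
    simp [E]
    rfl
  have hxs : ∀ (i : Fin m) (u : L) (v : N), (X (Sum.inl i) : BGS K m n) • e.symm (u ⊗ₜ[K] v)
        = e.symm (((X i : MvPolynomial (Fin m) K) • u) ⊗ₜ[K] v) := by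
    intro i u v; rw [← hx, e.symm_apply_apply]
  have hys : ∀ (i : Fin n) (u : L) (v : N), (X (Sum.inr i) : BGS K m n) • e.symm (u ⊗ₜ[K] v)
        = e.symm (u ⊗ₜ[K] ((X i : MvPolynomial (Fin n) K) • v)) := by
    intro i u v; rw [← hy, e.symm_apply_apply]
  have hEx : ∀ k (i : Fin m) w, E k ((X (Sum.inl i) : BGS K m n) • w) = 
      if 1 ≤ k then (X (Sum.inl i) : BGS K m n) • E (k-1) w else 0 := by
    intro k i w
    induction w using M_ind e with
    | h u v =>
      rw [hxs, hE, hE, hxs, hsm 1 k _ _ (isHomogeneous_X _ _)]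
      split_ifs
      · rfl
      · simp
    | hadd x y hx hy => rw [smul_add, map_add, hx, hy, map_add, smul_add]; split_ifs <;> simp
    | h0 => simp
  have hEy : ∀ k (i : Fin n) w, E k ((X (Sum.inr i) : BGS K m n) • w) = (X (Sum.inr i) : BGS K m n) • E k w := by
    intro k i w
    induction w using M_ind e with
    | h u v => rw [hys, hE, hE, hys]
    | hadd x y hx hy => rw [smul_add, map_add, hx, hy, map_add, smul_add]
    | h0 => simp
  have main : ∀ (h : BGS K m n) (w : M) (k : ℕ),
      E k (h • w) - iy K m n (ev0 K m n h) • E k w ∈ Submodule.span (BGS K m n) {v | ∃ j < k, v = E j w} := by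
    intro h
    induction h using MvPolynomial.induction_on with
    | C c =>
      intro w k
      rw [ev0, aeval_C, MvPolynomial.algebraMap_eq, iy, rename_C, C_smul', C_smul', map_smul, sub_self]
      exact zero_mem _
    | add p q hp hq =>
      intro w k
      rw [add_smul, map_add, map_add, map_add, add_smul, add_sub_add_comm]
      exact add_mem (hp w k) (hq w k)
    | mul_X p j hp =>
      intro w k
      rcases j with i | i
      · have h1 := hp ((X (Sum.inl i) : BGS K m n) • w) k
        have h2 : ev0 K m n (p * X (Sum.inl i)) = 0 := by
          rw [map_mul, ev0, aeval_X]; simp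
        have h3 : ∀ j ≤ k, E j ((X (Sum.inl i) : BGS K m n) • w) ∈ Submodule.span (BGS K m n) {v | ∃ j < k, v = E j w} := by
          intro j hj
          rw [hEx]
          split_ifs
          · exact Submodule.smul_mem _ _ (Submodule.subset_span ⟨j - 1, by omega, rfl⟩)
          · exact zero_mem _
        rw [h2, map_zero, zero_smul, sub_zero, mul_smul]
        have h4 := add_mem (Submodule.span_le.2 (by rintro _ ⟨j, hj, rfl⟩; exact h3 j hj.le) h1)
          (Submodule.smul_mem _ (iy K m n (ev0 K m n p)) (h3 k le_rfl))
        rwa [sub_add_cancel] at h4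
      · have h1 := hp ((X (Sum.inr i) : BGS K m n) • w) k
        have h2 : iy K m n (ev0 K m n (p * X (Sum.inr i))) = iy K m n (ev0 K m n p) * X (Sum.inr i) := by
          rw [map_mul, map_mul]; congr 1; rw [ev0, aeval_X]; simp
        rw [h2, mul_smul, mul_smul, ← hEy]
        refine Submodule.span_le.2 ?_ h1
        rintro _ ⟨j, hj, rfl⟩
        rw [hEy]
        exact Submodule.smul_mem _ _ (Submodule.subset_span ⟨j, hj, rfl⟩)
  have hfin : ∀ w, ∃ r, ∀ r' ≥ r, w = ∑ k ∈ Finset.range r', E k w := by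
    intro w
    induction w using M_ind e with
    | h u v =>
      obtain ⟨r, hr⟩ := hsum u
      refine ⟨r, fun r' hr' => ?_⟩
      simp only [hE]
      rw [← map_sum, ← TensorProduct.sum_tmul, ← hr r' hr']
    | hadd x y hx hy =>
      obtain ⟨r, hr⟩ := hx
      obtain ⟨s, hs⟩ := hy
      refine ⟨max r s, fun r' hr' => ?_⟩
      simp only [map_add]
      rw [Finset.sum_add_distrib, ← hr r' (le_trans (le_max_left _ _) hr'), ← hs r' (le_trans (le_max_right _ _) hr')]
    | h0 => exact ⟨0, by simp⟩
  obtain ⟨r, hr⟩ := hfin w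
  rw [Ideal.mem_comap]
  refine core P w hw (fun k => E k w) r (hr r le_rfl) _ fun k => ?_
  have := main h w k
  rw [(hw h).1 hhP, map_zero, zero_sub] at this
  simpa using neg_mem this

end AssM
end MaxDepthAux

namespace MaxDepthAux
section Noeth

lemma dim_integral {B D : Type} [CommRing B] [CommRing D] [IsDomain D] [Algebra B D] [Algebra.IsIntegral B D]
    (hinj : Function.Injective (algebraMap B D)) : ringKrullDim D = ringKrullDim B := by
  apply le_antisymm
  · refine Order.krullDim_le_of_strictMono (PrimeSpectrum.comap (algebraMap B D)) ?_
    intro P Q hPQ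
    exact Ideal.IsIntegral.comap_lt_comap (R := B) (I := P.asIdeal) (J := Q.asIdeal) hPQ
  · refine iSup_le fun l => ?_
    obtain ⟨P, hP, hPl⟩ := Ideal.exists_ideal_over_prime_of_isIntegral_of_isDomain (S := D)
      (RelSeries.head l).asIdeal (by rw [(RingHom.injective_iff_ker_eq_bot _).1 hinj]; exact bot_le)
    have : P.LiesOver (RelSeries.head l).asIdeal := ⟨hPl.symm⟩
    obtain ⟨L, hL, -⟩ := Ideal.exists_ltSeries_of_hasGoingUp l P
    rw [← hL]
    exact le_iSup (fun p : LTSeries (PrimeSpectrum D) => (p.length : WithBot ℕ∞)) L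

lemma aeval_scale {K σ R : Type} [Field K] [CommRing R] [Algebra K R] (f : MvPolynomial σ K) (d : ℕ)
    (hf : f.IsHomogeneous d) (a : σ → K) (z : R) :
    aeval (fun i => a i • z) f = (eval a f) • z ^ d := by
  rw [aeval_def, eval₂_eq, eval_eq, Finset.sum_smul]
  refine Finset.sum_congr rfl fun s hs => ?_
  have h1 : ∀ i, (a i • z) ^ (s i) = algebraMap K R (a i ^ s i) * z ^ s i := by
    intro i
    rw [Algebra.smul_def, mul_pow, map_pow]
  have h2 : ∑ i ∈ s.support, s i = d := by
    exact (hf.degree_eq_sum_deg_support hs).symm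
  simp only [h1]
  rw [Finset.prod_mul_distrib, Finset.prod_pow_eq_pow_sum, h2, ← map_prod, Algebra.smul_def, map_mul, mul_assoc]

variable {K : Type} [Field K] {n : ℕ}

/-- elementary linear substitution -/
def tau (j : Fin n) (c : Fin n → K) : MvPolynomial (Fin n) K →ₐ[K] MvPolynomial (Fin n) K :=
  aeval (fun i => if i = j then X j else X i - C (c i) * X j)

lemma tau_tau (j : Fin n) (c : Fin n → K) : (tau j c).comp (tau j (-c)) = AlgHom.id K _ := by
  ext i
  by_cases h : i = j
  · subst h; simp [tau]
  · simp [tau, h]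

def tauE (j : Fin n) (c : Fin n → K) : MvPolynomial (Fin n) K ≃ₐ[K] MvPolynomial (Fin n) K :=
  AlgEquiv.ofAlgHom (tau j c) (tau j (-c)) (tau_tau j c) (by simpa using tau_tau j (-c))

lemma tauE_X (j : Fin n) (c : Fin n → K) (i : Fin n) : 
    tauE j c (X i) = if i = j then X j else X i - C (c i) * X j := by
  exact aeval_X _ i

theorem noether [Infinite K] (p : Ideal (MvPolynomial (Fin n) K)) [hp : p.IsPrime]
    (hom : ∀ f ∈ p, ∀ i, homogeneousComponent i f ∈ p) :
    ∃ (T : Finset (Fin n)) (ψ : MvPolynomial (Fin n) K ≃ₐ[K] MvPolynomial (Fin n) K), 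
      (∀ j, (ψ (X j)).IsHomogeneous 1) ∧
      (∀ j, X j ∈ (Ideal.span ((fun i => ψ (X i)) '' T) ⊔ p).radical) ∧
      Function.Injective (aeval (fun i : T => Ideal.Quotient.mk p (ψ (X i))) : 
        MvPolynomial T K →ₐ[K] (MvPolynomial (Fin n) K ⧸ p)) := by
  classical
  let Good : Finset (Fin n) → Prop := fun T => 
    ∃ (ψ : MvPolynomial (Fin n) K ≃ₐ[K] MvPolynomial (Fin n) K), 
      (∀ j, (ψ (X j)).IsHomogeneous 1) ∧
      (∀ j, X j ∈ (Ideal.span ((fun i => ψ (X i)) '' T) ⊔ p).radical)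
  have h0 : ∃ k, ∃ T, Good T ∧ T.card = k := by
    refine ⟨_, Finset.univ, ⟨AlgEquiv.refl, fun j => isHomogeneous_X _ _, fun j => ?_⟩, rfl⟩
    apply Ideal.le_radical
    apply Ideal.mem_sup_left
    exact Ideal.subset_span ⟨j, by simp, rfl⟩
  obtain ⟨T, ⟨ψ, hlin, hrad⟩, hT⟩ := Nat.find_spec h0
  refine ⟨T, ψ, hlin, hrad, ?_⟩
  by_contra hni
  rw [injective_iff_map_eq_zero] at hni
  push Not at hni
  obtain ⟨f, hf0, hf⟩ := hni
  obtain ⟨d, hd⟩ : ∃ d, homogeneousComponent d f ≠ 0 := by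
    by_contra h
    push Not at h
    apply hf
    rw [← sum_homogeneousComponent f]
    exact Finset.sum_eq_zero fun i _ => h i
  set θ : T → MvPolynomial (Fin n) K := fun i => ψ (X i) with hθ
  have hθp : ∀ g : MvPolynomial T K, aeval (fun i : T => Ideal.Quotient.mk p (ψ (X i))) g = Ideal.Quotient.mk p (aeval θ g) := by
    intro g
    have : (aeval (fun i : T => Ideal.Quotient.mk p (ψ (X i))) : MvPolynomial T K →ₐ[K] _) = (Ideal.Quotient.mkₐ K p).comp (aeval θ) := by
      ext i; simp [hθ]
    rw [this]; rfl
  have hFp : aeval θ f ∈ p := by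
    rw [← Ideal.Quotient.eq_zero_iff_mem, ← hθp, hf0]
  have hcomp : ∀ i, (aeval θ (homogeneousComponent i f)).IsHomogeneous i := by
    intro i
    have := (homogeneousComponent_isHomogeneous i f).aeval θ (n := 1) (fun i => hlin i)
    simpa using this
  have hgp : aeval θ (homogeneousComponent d f) ∈ p := by
    have h1 := hom _ hFp d
    have h2 : homogeneousComponent d (aeval θ f) = aeval θ (homogeneousComponent d f) := by
      conv_lhs => rw [← sum_homogeneousComponent f]
      rw [map_sum, map_sum]
      rw [Finset.sum_congr rfl fun i _ => homogeneousComponent_of_mem (m := d) (hcomp i), Finset.sum_ite_eq]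
      split_ifs with h
      · rfl
      · rw [homogeneousComponent_eq_zero d f, map_zero]
        simpa using h
    rwa [h2] at h1
  set g := homogeneousComponent d f with hg
  have hgh : g.IsHomogeneous d := homogeneousComponent_isHomogeneous d f
  obtain ⟨a, ha⟩ : ∃ a, eval a g ≠ 0 := by
    by_contra h
    push Not at h
    exact hd (MvPolynomial.funext (by simpa using h))
  obtain ⟨j, hj⟩ : ∃ j, a j ≠ 0 := by
    by_contra h
    push Not at h
    have h2 : d = 0 := by
      by_contra hd0
      apply ha
      have h3 := aeval_scale g d hgh (fun _ => (1:K)) (0 : K)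
      rw [zero_pow hd0] at h3
      have h4 : a = fun _ : T => (1:K) • (0:K) := by funext i; simp [h i]
      rw [h4]
      exact h3.trans (smul_zero _)
    rw [h2] at hg
    rw [homogeneousComponent_zero] at hg
    rw [hg, aeval_C] at hgp
    rw [hg, eval_C] at ha
    exact hp.ne_top (Ideal.eq_top_of_isUnit_mem _ hgp ((IsUnit.mk0 _ ha).map _))
  -- new coordinates
  let a' : Fin n → K := fun i => if h : i ∈ T then a ⟨i, h⟩ / a j else 0
  have ha' : ∀ i : T, a' i = a i / a j := fun i => by simp [a']
  let ψ' := (tauE (j : Fin n) a').trans ψ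
  have hψ' : ∀ i, ψ' (X i) = if i = j then ψ (X j) else ψ (X i) - C (a' i) * ψ (X j) := by
    intro i
    change ψ (tauE _ _ _) = _
    rw [tauE_X]
    split_ifs
    · rfl
    · rw [map_sub, map_mul]; congr 2
      exact ψ.commutes _
  have : Good (T.erase j) := by
    refine ⟨ψ', ?_, ?_⟩
    · intro i
      rw [hψ']
      split_ifs
      · exact hlin _
      · exact (hlin _).sub ((hlin _).C_mul _)
    · set I' := Ideal.span ((fun i => ψ' (X i)) '' (T.erase j : Finset (Fin n))) ⊔ p with hI'
      have hmod : ∀ i : T, Ideal.Quotient.mk I' (θ i) = (a i) • ((a j)⁻¹ • Ideal.Quotient.mk I' (θ j)) := by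
        intro i
        rw [smul_smul, ← div_eq_mul_inv]
        by_cases h : i = j
        · subst h; rw [div_self hj, one_smul]
        · have h' : (i : Fin n) ≠ j := fun h2 => h (Subtype.ext h2)
          have h3 : ψ' (X (i : Fin n)) ∈ I' := by
            apply Ideal.mem_sup_left
            apply Ideal.subset_span
            exact ⟨i, by simp [h'], rfl⟩
          rw [hψ', if_neg h', ← Ideal.Quotient.eq_zero_iff_mem, map_sub, sub_eq_zero] at h3
          rw [h3, ha', ← smul_eq_C_mul]
          rfl
      have hj0 : (Ideal.Quotient.mk I' (θ j)) ^ d = 0 := by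
        have h1 : Ideal.Quotient.mk I' (aeval θ g) = 0 :=
          Ideal.Quotient.eq_zero_iff_mem.2 (Ideal.mem_sup_right hgp)
        have h2 : Ideal.Quotient.mk I' (aeval θ g) = aeval (fun i => Ideal.Quotient.mk I' (θ i)) g := by
          have : (aeval (fun i : T => Ideal.Quotient.mk I' (θ i)) : MvPolynomial T K →ₐ[K] _) = (Ideal.Quotient.mkₐ K I').comp (aeval θ) := by
            ext i; simp
          rw [this]; rfl
        rw [h2] at h1
        rw [show (fun i => Ideal.Quotient.mk I' (θ i)) = _ from _root_.funext hmod] at h1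
        rw [aeval_scale g d hgh a, smul_pow, smul_smul] at h1
        exact (smul_eq_zero.1 h1).resolve_left (mul_ne_zero ha (pow_ne_zero _ (inv_ne_zero hj)))
      have hθj : θ j ∈ I'.radical := by
        refine ⟨d, ?_⟩
        rw [← Ideal.Quotient.eq_zero_iff_mem, map_pow, hj0]
      have hθi : ∀ i ∈ T, ψ (X i) ∈ I'.radical := by
        intro i hi
        have h1 := hmod ⟨i, hi⟩
        rw [smul_smul] at h1
        have h2 : ψ (X i) - C (a ⟨i, hi⟩ * (a j)⁻¹) * θ j ∈ I' := by
          rw [← Ideal.Quotient.eq_zero_iff_mem, map_sub, sub_eq_zero, ← smul_eq_C_mul]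
          exact h1
        have h3 := add_mem (Ideal.le_radical h2) (Ideal.mul_mem_left _ (C (a ⟨i, hi⟩ * (a j)⁻¹)) hθj)
        rwa [sub_add_cancel] at h3
      intro i
      refine (Ideal.radical_le_radical_iff.2 ?_) (hrad i)
      refine sup_le (Ideal.span_le.2 ?_) (le_trans le_sup_right Ideal.le_radical)
      rintro _ ⟨i, hi, rfl⟩
      exact hθi i hi
  have hlt : (T.erase j).card < Nat.find h0 := by
    rw [← hT]
    exact Finset.card_erase_lt_of_mem j.2
  exact Nat.find_min h0 hlt ⟨_, this, rfl⟩

end Noeth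
end MaxDepthAux

namespace MaxDepthAux
section Fin

lemma exists_functional {B D : Type} [CommRing B] [IsDomain B] [CommRing D] [IsDomain D] [Algebra B D]
    [Module.Finite B D] (hinj : Function.Injective (algebraMap B D)) :
    ∃ l : D →ₗ[B] B, l 1 ≠ 0 := by
  classical
  let F := FractionRing B
  let S := nonZeroDivisors B
  let V := LocalizedModule S D
  let mk : D →ₗ[B] V := LocalizedModule.mkLinearMap S D
  have h1 : mk 1 ≠ 0 := by
    intro h
    obtain ⟨c, hc⟩ := (IsLocalizedModule.eq_zero_iff S mk).1 h
    have h2 : algebraMap B D c = 0 := by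
      rw [Algebra.algebraMap_eq_smul_one]; exact hc
    exact nonZeroDivisors.ne_zero c.2 (hinj (by rw [h2, map_zero]))
  obtain ⟨f, hf⟩ : ∃ f : Module.Dual F V, f (mk 1) ≠ 0 := by
    by_contra h
    push Not at h
    exact h1 ((Module.forall_dual_apply_eq_zero_iff F _).1 h)
  let g : D →ₗ[B] F := (f.restrictScalars B) ∘ₗ mk
  obtain ⟨s, hs⟩ := (Module.Finite.fg_top : (⊤ : Submodule B D).FG)
  obtain ⟨b, hb⟩ := IsLocalization.exist_integer_multiples_of_finset S (s.image g)
  have hr : ∀ d, ((b : B) • g) d ∈ LinearMap.range (Algebra.linearMap B F) := by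
    intro d
    have hd : d ∈ Submodule.span B (s : Set D) := by rw [hs]; trivial
    induction hd using Submodule.span_induction with
    | mem x hx =>
      obtain ⟨y, hy⟩ := hb (g x) (Finset.mem_image_of_mem _ hx)
      exact ⟨y, hy⟩
    | zero => rw [map_zero]; exact zero_mem _
    | add x y _ _ h1 h2 => rw [map_add]; exact add_mem h1 h2
    | smul a x _ h1 => rw [map_smul]; exact Submodule.smul_mem _ _ h1
  have hFi : Function.Injective (Algebra.linearMap B F) := IsFractionRing.injective B F
  let l : D →ₗ[B] B := (LinearEquiv.ofInjective _ hFi).symm.toLinearMap ∘ₗ ((b : B) • g).codRestrict _ hr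
  have hl : ∀ d, algebraMap B F (l d) = (b : B) • g d := by
    intro d
    exact congrArg Subtype.val ((LinearEquiv.ofInjective _ hFi).apply_symm_apply (((b : B) • g).codRestrict _ hr d))
  refine ⟨l, fun h => ?_⟩
  have h2 := hl 1
  rw [h, map_zero, Algebra.smul_def] at h2
  rcases mul_eq_zero.1 h2.symm with h3 | h3
  · exact nonZeroDivisors.ne_zero b.2 (hFi (by rw [map_zero]; exact h3))
  · exact hf h3

variable {K : Type} [Field K] {n : ℕ}

lemma hc_mul {σ : Type} (θ g : MvPolynomial σ K) (hθ : θ.IsHomogeneous 1) (d : ℕ) :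
    homogeneousComponent (d+1) (g * θ) = homogeneousComponent d g * θ := by
  classical
  conv_lhs => rw [← sum_homogeneousComponent g]
  rw [Finset.sum_mul, map_sum]
  rw [Finset.sum_congr rfl fun i _ => homogeneousComponent_of_mem (m := d+1) ((homogeneousComponent_isHomogeneous i g).mul hθ)]
  simp only [add_left_inj]
  rw [Finset.sum_ite_eq]
  split_ifs with h
  · rfl
  · rw [homogeneousComponent_eq_zero d g, zero_mul]
    simpa using h

lemma fin_B (p : Ideal (MvPolynomial (Fin n) K))
    (hom : ∀ f ∈ p, ∀ i, homogeneousComponent i f ∈ p) (T : Finset (Fin n))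
    (θ : Fin n → MvPolynomial (Fin n) K) 
    (hlin : ∀ j, (θ j).IsHomogeneous 1)
    (hrad : ∀ j, X j ∈ (Ideal.span (θ '' T) ⊔ p).radical)
    {B D : Type} [CommRing D] [Algebra K D] [CommRing B] [Algebra K B] [Algebra B D] [IsScalarTower K B D]
    (π : MvPolynomial (Fin n) K →ₐ[K] D) (hπs : Function.Surjective π) (hπ : ∀ q ∈ p, π q = 0)
    (x : T → B) (hx : ∀ i : T, algebraMap B D (x i) = π (θ i)) :
    Module.Finite B D := by
  classical
  set I0 := Ideal.span (θ '' T) ⊔ p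
  obtain ⟨N, hN⟩ := Ideal.exists_pow_le_of_le_radical_of_fg (I := Ideal.span (Set.range (X : Fin n → MvPolynomial (Fin n) K))) (J := I0)
    (Ideal.span_le.2 (by rintro _ ⟨j, rfl⟩; exact hrad j)) (IsNoetherian.noetherian _)
  have hfin : Set.Finite {s : Fin n →₀ ℕ | s.degree ≤ N} := Finsupp.finite_of_degree_le N
  set G : Set D := (fun s => π (monomial s 1)) '' {s : Fin n →₀ ℕ | s.degree ≤ N}
  have hK : ∀ (c : K) x, x ∈ Submodule.span B G → c • x ∈ Submodule.span B G := by
    intro c x hx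
    rw [← algebraMap_smul B c x]
    exact Submodule.smul_mem _ _ hx
  have main : ∀ d, ∀ f : MvPolynomial (Fin n) K, f.IsHomogeneous d → π f ∈ Submodule.span B G := by
    intro d
    induction d with
    | zero =>
      intro f hf
      rw [← totalDegree_zero_iff_isHomogeneous, totalDegree_eq_zero_iff_eq_C] at hf
      have : π f = coeff 0 f • π (monomial 0 1) := by
        conv_lhs => rw [hf]
        rw [← map_smul, smul_monomial, smul_eq_mul, mul_one]; rfl
      rw [this]
      exact hK _ _ (Submodule.subset_span ⟨0, by simp, rfl⟩)
    | succ d ih =>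
      intro f hf
      by_cases hd : d + 1 ≤ N
      · have : π f = ∑ s ∈ f.support, coeff s f • π (monomial s 1) := by
          conv_lhs => rw [f.as_sum]
          rw [map_sum]
          refine Finset.sum_congr rfl fun s _ => ?_
          rw [← map_smul, smul_monomial, smul_eq_mul, mul_one]
        rw [this]
        refine Submodule.sum_mem _ fun s hs => hK _ _ (Submodule.subset_span ⟨s, ?_, rfl⟩)
        have h1 := hf.degree_eq_sum_deg_support hs
        change s.degree ≤ N
        rw [Finsupp.degree_apply, ← h1]; omega
      · have hfm : f ∈ I0 := by
          apply hN
          refine Ideal.pow_le_pow_right (Nat.le_of_not_le hd) ?_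
          rw [Ideal.mem_span_pow_iff_exists_isHomogeneous]
          refine ⟨MvPolynomial.map C f, hf.map C, ?_⟩
          rw [MvPolynomial.eval_map]
          exact eval₂_eta f
        obtain ⟨y, hy, q, hq, rfl⟩ := Submodule.mem_sup.1 hfm
        obtain ⟨c, rfl⟩ := (Submodule.mem_span_image_finset_iff_exists_fun _).1 hy
        have h1 := homogeneousComponent_of_mem (m := d+1) hf
        rw [if_pos rfl, map_add, map_sum] at h1
        simp only [smul_eq_mul, hc_mul _ _ (hlin _)] at h1
        have h2 : ∀ i : T, π (homogeneousComponent d (c i) * θ i) ∈ Submodule.span B G := by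
          intro i
          have : π (homogeneousComponent d (c i) * θ i) = 
              x i • π (homogeneousComponent d (c i)) := by
            rw [Algebra.smul_def, mul_comm, map_mul, hx]
          rw [this]
          exact Submodule.smul_mem _ _ (ih _ (homogeneousComponent_isHomogeneous _ _))
        simp only [smul_eq_mul]
        rw [← h1, map_add, hπ _ (hom q hq (d+1)), add_zero, map_sum]
        exact Submodule.sum_mem _ fun i _ => h2 i
  have hGf : G.Finite := hfin.image _
  refine ⟨⟨hGf.toFinset, ?_⟩⟩
  rw [Set.Finite.coe_toFinset, eq_top_iff]
  rintro x -
  obtain ⟨f, rfl⟩ := hπs x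
  rw [← sum_homogeneousComponent f, map_sum]
  exact Submodule.sum_mem _ fun i _ => main i _ (homogeneousComponent_isHomogeneous _ _)

end Fin
end MaxDepthAux

namespace MaxDepthAux
section CD

lemma lI_map {R R' ι : Type} [CommRing R] [CommRing R'] (Φ : R ≃+* R') (w : ι → R) (l : List ι) (x : R) :
    Φ x ∈ lI (fun i => Φ (w i)) l ↔ x ∈ lI w l := by
  have h : ∀ l : List ι, lI (fun i => Φ (w i)) l = (lI w l).map (Φ : R →+* R') := by
    intro l
    induction l with
    | nil => simp [lI, Ideal.map_bot]
    | cons a l ih => 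
      rw [lI, lI, ih, Ideal.map_sup, Ideal.map_span, Set.image_singleton]; rfl
  rw [h]
  constructor
  · intro hx
    obtain ⟨y, hy, hxy⟩ := (Ideal.mem_map_iff_of_surjective (Φ : R →+* R') Φ.surjective).1 hx
    have : y = x := Φ.injective hxy
    rwa [← this]
  · exact fun hx => Ideal.mem_map_of_mem (Φ : R →+* R') hx

lemma RegL_map {R R' ι : Type} [CommRing R] [CommRing R'] (Φ : R ≃+* R') (w : ι → R) (l : List ι)
    (h : RegL w l) : RegL (fun i => Φ (w i)) l := by
  induction l with
  | nil => trivial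
  | cons a l ih =>
    refine ⟨ih h.1, fun x hx => ?_⟩
    obtain ⟨y, rfl⟩ := Φ.surjective x
    rw [← map_mul, lI_map] at hx
    rw [lI_map]
    exact h.2 y hx

lemma RegL_X {K σ ι : Type} [Field K] (v : ι → σ) (hv : Function.Injective v) (t : ℕ) (l : List ι)
    (hl : l.Nodup) : RegL (fun i => (X (v i) : MvPolynomial σ K) ^ t) l := by
  have hlI : ∀ l : List ι, lI (fun i => (X (v i) : MvPolynomial σ K) ^ t) l =
      Ideal.span ((fun s => monomial s (1 : K)) '' {s | ∃ i ∈ l, s = Finsupp.single (v i) t}) := by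
    intro l
    apply le_antisymm
    · rw [lI_le_iff]
      intro i hi
      exact Ideal.subset_span ⟨_, ⟨i, hi, rfl⟩, by rw [X_pow_eq_monomial]⟩
    · rw [Ideal.span_le]
      rintro _ ⟨_, ⟨i, hi, rfl⟩, rfl⟩
      have := (lI_le_iff (fun i => (X (v i) : MvPolynomial σ K) ^ t) l _).1 le_rfl i hi
      simpa [X_pow_eq_monomial] using this
  induction l with
  | nil => trivial
  | cons a l ih =>
    rw [List.nodup_cons] at hl
    refine ⟨ih hl.2, fun x hx => ?_⟩
    rw [hlI, mem_ideal_span_monomial_image] at hx ⊢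
    intro μ hμ
    obtain ⟨s, ⟨i, hi, rfl⟩, hs⟩ := hx (Finsupp.single (v a) t + μ) (by
      rw [mem_support_iff]
      change coeff _ ((X (v a)) ^ t * x) ≠ 0
      rw [X_pow_eq_monomial, coeff_monomial_mul, one_mul]
      exact mem_support_iff.1 hμ)
    refine ⟨_, ⟨i, hi, rfl⟩, ?_⟩
    rw [Finsupp.single_le_iff] at hs ⊢
    have hne : v a ≠ v i := fun h => hl.1 (by rw [hv h]; exact hi)
    simpa [Finsupp.single_apply, hne] using hs

lemma hc0_abs {K : Type} [Field K] {n : ℕ} (T : Finset (Fin n)) {R D : Type} [CommRing R] [CommRing D]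
    [Algebra (MvPolynomial T K) D] (P : Ideal R) (γ : R →+* D) (hγ : ∀ a ∈ P, γ a = 0) (θ : Fin n → R)
    (hθ : ∀ i : T, γ (θ i) = algebraMap (MvPolynomial T K) D (X i))
    (l : D →ₗ[MvPolynomial T K] MvPolynomial T K) (hl : l 1 ≠ 0) :
    ∃ t0, ∀ k, (T.toList.map (fun i => θ i ^ k)).prod • (1 : R ⧸ P) ∉ 
      lI (fun i => θ i ^ (t0 + k)) T.toList • (⊤ : Submodule R (R ⧸ P)) := by
  classical
  refine ⟨(l 1).totalDegree + 1, fun k hk => ?_⟩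
  set t0 := (l 1).totalDegree + 1 with ht0
  let I : Ideal (MvPolynomial T K) := Ideal.span ((fun s => monomial s (1 : K)) '' (Set.range fun i : T => Finsupp.single i (t0 + k)))
  let J : Ideal D := 
    { carrier := {d | ∀ d', l (d * d') ∈ I}
      add_mem' := by
        intro a b ha hb d'
        rw [add_mul, map_add]; exact add_mem (ha d') (hb d')
      zero_mem' := by intro d'; simp
      smul_mem' := by
        intro c x hx d'
        rw [smul_eq_mul, mul_comm c, mul_assoc]; exact hx _ }
  have hlIJ : lI (fun i => θ i ^ (t0 + k)) T.toList ≤ J.comap γ := by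
    rw [lI_le_iff]
    intro i hi
    rw [Finset.mem_toList] at hi
    intro d'
    rw [map_pow, hθ ⟨i, hi⟩, ← map_pow, ← Algebra.smul_def, map_smul, smul_eq_mul]
    apply Ideal.mul_mem_right
    exact Ideal.subset_span ⟨_, ⟨⟨i, hi⟩, rfl⟩, by rw [X_pow_eq_monomial]⟩
  let γ' : R ⧸ P →+* D := Ideal.Quotient.lift P γ hγ
  have hγ' : ∀ a c, γ' (a • c) = γ a * γ' c := by
    intro a c
    obtain ⟨c, rfl⟩ := Ideal.Quotient.mk_surjective c
    change γ (a * c) = γ a * γ c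
    rw [map_mul]
  have h1 : ∀ c ∈ lI (fun i => θ i ^ (t0 + k)) T.toList • (⊤ : Submodule R (R ⧸ P)), γ' c ∈ J := by
    intro c hc
    induction hc using Submodule.smul_induction_on' with
    | smul a ha c _ => rw [hγ']; exact J.mul_mem_right _ (hlIJ ha)
    | add x _ y _ hx hy => rw [map_add]; exact add_mem hx hy
  have h2 := h1 _ hk 1
  rw [hγ', map_one, mul_one, mul_one] at h2
  have h3 : γ (T.toList.map (fun i => θ i ^ k)).prod = algebraMap (MvPolynomial T K) D (monomial (Finsupp.equivFunOnFinite.symm fun _ => k) 1) := by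
    rw [Finset.prod_map_toList, map_prod, ← Finset.prod_coe_sort]
    have : (monomial (Finsupp.equivFunOnFinite.symm fun _ => k) 1 : MvPolynomial T K) = ∏ i : T, X i ^ k := by
      rw [monomial_eq, C_1, one_mul, Finsupp.prod_fintype _ _ (by simp)]
      rfl
    rw [this, map_prod]
    refine Finset.prod_congr rfl fun i _ => ?_
    rw [map_pow, map_pow, hθ]
  rw [h3, ← mul_one (algebraMap _ D _), ← Algebra.smul_def, map_smul, smul_eq_mul] at h2
  obtain ⟨μ, hμ⟩ := support_nonempty.2 hl
  obtain ⟨_, ⟨i, rfl⟩, hs⟩ := mem_ideal_span_monomial_image.1 h2 ((Finsupp.equivFunOnFinite.symm fun _ => k) + μ) (by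
    rw [mem_support_iff, coeff_monomial_mul, one_mul]
    exact mem_support_iff.1 hμ)
  rw [Finsupp.single_le_iff] at hs
  have h4 : t0 + k ≤ k + μ i := hs
  have h5 : μ i ≤ (l 1).totalDegree := le_trans (Finsupp.le_degree i μ) (le_totalDegree hμ)
  omega

variable {K : Type} [Field K] {m n : ℕ}

lemma Q_map : idealQ K m n = (Ideal.span (Set.range (X : Fin n → MvPolynomial (Fin n) K))).map (iy K m n) := by
  rw [Ideal.map_span, ← Set.range_comp, idealQ]
  congr 2
  funext j
  exact (rename_X _ _).symm

lemma p_le (p : Ideal (MvPolynomial (Fin n) K)) [hp : p.IsPrime]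
    (hom : ∀ f ∈ p, ∀ i, homogeneousComponent i f ∈ p) : 
    p ≤ Ideal.span (Set.range (X : Fin n → MvPolynomial (Fin n) K)) := by
  intro f hf
  have h1 := hom f hf 0
  rw [homogeneousComponent_zero] at h1
  have h2 : coeff 0 f = 0 := by
    by_contra h
    exact hp.ne_top (Ideal.eq_top_of_isUnit_mem _ h1 ((IsUnit.mk0 _ h).map C))
  rw [← Set.image_univ, mem_ideal_span_X_image]
  intro s hs
  by_contra h
  push Not at h
  have : s = 0 := by ext i; simpa using h i (Set.mem_univ _)
  subst this
  exact mem_support_iff.1 hs h2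

/-- extension of an automorphism of K[y] to S -/
def extE (ψ : MvPolynomial (Fin n) K ≃ₐ[K] MvPolynomial (Fin n) K) : BGS K m n ≃+* BGS K m n :=
  ((sumAlgEquiv K (Fin m) (Fin n)).toRingEquiv.trans (mapEquiv (Fin m) ψ.toRingEquiv)).trans
    (sumAlgEquiv K (Fin m) (Fin n)).symm.toRingEquiv

lemma extE_X (ψ : MvPolynomial (Fin n) K ≃ₐ[K] MvPolynomial (Fin n) K) (j : Fin n) :
    extE (m := m) ψ (X (Sum.inr j)) = iy K m n (ψ (X j)) := by
  have h1 : ∀ a : MvPolynomial (Fin n) K, sumAlgEquiv K (Fin m) (Fin n) (iy K m n a) = C a := by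
    intro a
    induction a using MvPolynomial.induction_on with
    | C c => rw [show iy K m n (C c) = C c from rename_C _ _, sumAlgEquiv_C_inl]
    | add p q hp hq => rw [map_add, map_add, hp, hq, map_add]
    | mul_X p j hp => rw [map_mul, map_mul, hp, map_mul]; congr 1; rw [show iy K m n (X j) = X (Sum.inr j) from rename_X _ _, sumAlgEquiv_X_inr]
  have h2 : (X (Sum.inr j) : BGS K m n) = iy K m n (X j) := (rename_X _ _).symm
  change (sumAlgEquiv K (Fin m) (Fin n)).symm (mapEquiv (Fin m) ψ.toRingEquiv (sumAlgEquiv K (Fin m) (Fin n) _)) = _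
  rw [AlgEquiv.symm_apply_eq, h1, h2, h1]
  exact map_C _ _

theorem cd_main [Infinite K] (p : Ideal (MvPolynomial (Fin n) K)) [hp : p.IsPrime]
    (hom : ∀ f ∈ p, ∀ i, homogeneousComponent i f ∈ p) (P : Ideal (BGS K m n))
    (hPc : P.comap (iy K m n) = p) (hev : ∀ h ∈ P, ev0 K m n h ∈ p) :
    (cohDim (BGS K m n) (idealQ K m n) (BGS K m n ⧸ P) : WithBot ℕ∞) = ringKrullDim (MvPolynomial (Fin n) K ⧸ p) := by
  classical
  obtain ⟨T, ψ, hlin, hrad, hinj⟩ := noether p hom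
  let β := (aeval (fun i : T => Ideal.Quotient.mk p (ψ (X i))) : 
        MvPolynomial T K →ₐ[K] (MvPolynomial (Fin n) K ⧸ p))
  obtain ⟨D, hD, hDd, hDK, ⟨φ⟩⟩ : ∃ (D : Type) (_ : CommRing D) (_ : IsDomain D) (_ : Algebra K D), 
      Nonempty (D ≃ₐ[K] (MvPolynomial (Fin n) K ⧸ p)) := ⟨_, inferInstance, inferInstance, inferInstance, ⟨AlgEquiv.refl⟩⟩
  let β' : MvPolynomial T K →ₐ[K] D := φ.symm.toAlgHom.comp β
  let _ : Algebra (MvPolynomial T K) D := β'.toRingHom.toAlgebra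
  have hst : IsScalarTower K (MvPolynomial T K) D := IsScalarTower.of_algebraMap_eq fun c => (β'.commutes c).symm
  let π : MvPolynomial (Fin n) K →ₐ[K] D := φ.symm.toAlgHom.comp (Ideal.Quotient.mkₐ K p)
  have hπs : Function.Surjective π := φ.symm.surjective.comp Ideal.Quotient.mk_surjective
  have hπ : ∀ q ∈ p, π q = 0 := by
    intro q hq
    change φ.symm (Ideal.Quotient.mk p q) = 0
    rw [Ideal.Quotient.eq_zero_iff_mem.2 hq, map_zero]
  have hβX : ∀ i : T, algebraMap (MvPolynomial T K) D (X i) = π (ψ (X i)) := by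
    intro i
    change φ.symm (β (X i)) = φ.symm (Ideal.Quotient.mk p _)
    congr 1
    exact aeval_X _ _
  have hinj' : Function.Injective (algebraMap (MvPolynomial T K) D) := φ.symm.injective.comp hinj
  have hfin : Module.Finite (MvPolynomial T K) D :=
    fin_B p hom T (fun i => ψ (X i)) hlin hrad π hπs hπ (fun i => X i) hβX
  obtain ⟨l, hl⟩ := exists_functional hinj'
  have hdim : ringKrullDim (MvPolynomial (Fin n) K ⧸ p) = T.card := by
    rw [← ringKrullDim_eq_of_ringEquiv φ.toRingEquiv, dim_integral hinj', MvPolynomial.ringKrullDim_of_isNoetherianRing]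
    simp
  rw [hdim]
  obtain ⟨t0, ht0⟩ := hc0_abs T P (π.toRingHom.comp (ev0 K m n).toRingHom) (fun a ha => hπ _ (hev a ha))
    (fun i => iy K m n (ψ (X i))) (fun i => by
      rw [hβX]
      change π (ev0 K m n (iy K m n _)) = _
      rw [ev0_iy]) l hl
  have := cd_eq (idealQ K m n) (p.map (iy K m n)) (BGS K m n ⧸ P) ?_ (fun i => iy K m n (ψ (X i))) T.toList ?_ ?_ ?_ ?_ 1 t0 ht0
  · rw [this, Finset.length_toList]
  · intro g hg c
    obtain ⟨c, rfl⟩ := Ideal.Quotient.mk_surjective c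
    have hgP : g ∈ P := by
      rw [← hPc] at hg
      exact Ideal.map_comap_le hg
    change Ideal.Quotient.mk P (g * c) = 0
    rw [Ideal.Quotient.eq_zero_iff_mem]
    exact P.mul_mem_right _ hgP
  · intro t
    have := RegL_map (extE (m := m) ψ) _ _ (RegL_X (K := K) (Sum.inr : Fin n → Fin m ⊕ Fin n) Sum.inr_injective t T.toList T.nodup_toList)
    simpa only [map_pow, extE_X] using this
  · intro i _
    rw [Q_map]
    apply Ideal.mem_map_of_mem
    rw [← Set.image_univ, mem_ideal_span_X_image]
    intro s hs
    by_contra h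
    push Not at h
    have h0 : s = 0 := by ext i; simpa using h i (Set.mem_univ _)
    subst h0
    exact mem_support_iff.1 hs ((hlin i).coeff_eq_zero (by simp))
  · rw [Q_map]
    exact Ideal.map_mono (p_le p hom)
  · intro t s
    set I := (lI (fun i => iy K m n (ψ (X i)) ^ t) T.toList ⊔ p.map (iy K m n) ^ s)
    have h1 : Ideal.span ((fun i => ψ (X i)) '' T) ⊔ p ≤ I.radical.comap (iy K m n) := by
      refine sup_le (Ideal.span_le.2 ?_) ?_
      · rintro _ ⟨i, hi, rfl⟩
        refine ⟨t, Ideal.mem_sup_left ?_⟩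
        exact (lI_le_iff (fun i => iy K m n (ψ (X i)) ^ t) T.toList _).1 le_rfl i (Finset.mem_toList.2 hi)
      · intro q hq
        refine ⟨s, Ideal.mem_sup_right ?_⟩
        exact Ideal.pow_mem_pow (Ideal.mem_map_of_mem _ hq) s
    rw [Q_map, Ideal.map_le_iff_le_comap, Ideal.span_le]
    rintro _ ⟨j, rfl⟩
    have h2 := Ideal.radical_mono h1 (hrad j)
    obtain ⟨k, hk⟩ := h2
    refine Ideal.radical_idem I ▸ (⟨k, ?_⟩ : iy K m n (X j) ∈ I.radical.radical)
    rw [← map_pow]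
    exact hk

end CD
end MaxDepthAux

namespace MaxDepthAux
open TensorProduct
section Final

lemma sInf_cast {ι : Type} (s : Set ι) (hs : s.Nonempty) (f : ι → ℕ) (D : Set (WithBot ℕ∞))
    (hD : D = {d | ∃ i ∈ s, d = (f i : WithBot ℕ∞)}) : ((sInf (f '' s) : ℕ) : WithBot ℕ∞) = sInf D := by
  subst hD
  refine (IsLeast.csInf_eq ⟨?_, ?_⟩).symm
  · obtain ⟨i, hi, h⟩ := Nat.sInf_mem (hs.image f)
    exact ⟨i, hi, by rw [h]⟩
  · rintro _ ⟨i, hi, rfl⟩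
    exact Nat.cast_le.2 (Nat.sInf_le ⟨i, hi, rfl⟩)

variable {K : Type} [Field K] {m n : ℕ}
    {L : Type} [AddCommGroup L] [Module K L] [Module (MvPolynomial (Fin m) K) L]
    [IsScalarTower K (MvPolynomial (Fin m) K) L]
    {N : Type} [AddCommGroup N] [Module K N] [Module (MvPolynomial (Fin n) K) N]
    [IsScalarTower K (MvPolynomial (Fin n) K) N]
    {M : Type} [AddCommGroup M] [Module K M] [Module (BGS K m n) M]
    [IsScalarTower K (BGS K m n) M]
    (e : M ≃ₗ[K] L ⊗[K] N)

lemma iy_C (a : MvPolynomial (Fin n) K) : sumAlgEquiv K (Fin m) (Fin n) (iy K m n a) = C a := by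
  induction a using MvPolynomial.induction_on with
  | C c => rw [show iy K m n (C c) = C c from rename_C _ _, sumAlgEquiv_C_inl]
  | add p q hp hq => rw [map_add, map_add, hp, hq, map_add]
  | mul_X p j hp =>
    rw [map_mul, map_mul, hp, map_mul]
    congr 1
    rw [show iy K m n (X j) = X (Sum.inr j) from rename_X _ _, sumAlgEquiv_X_inr]

lemma iy_flat : (iy K m n).toRingHom.Flat := by
  algebraize [(iy K m n).toRingHom]
  let E : BGS K m n ≃ₗ[MvPolynomial (Fin n) K] MvPolynomial (Fin m) (MvPolynomial (Fin n) K) :=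
    { (sumAlgEquiv K (Fin m) (Fin n)).toRingEquiv.toAddEquiv with
      map_smul' := fun a x => by
        change sumAlgEquiv K (Fin m) (Fin n) (iy K m n a * x) = a • sumAlgEquiv K (Fin m) (Fin n) x
        rw [map_mul, iy_C, MvPolynomial.smul_eq_C_mul] }
  exact Module.Flat.of_linearEquiv E

lemma grade_main [Nontrivial L] (hy : ∀ (j : Fin n) (u : L) (v : N),
      e ((X (Sum.inr j) : BGS K m n) • e.symm (u ⊗ₜ[K] v))
        = u ⊗ₜ[K] ((X j : MvPolynomial (Fin n) K) • v)) :
    extGrade (BGS K m n) (idealQ K m n) M = extGrade (MvPolynomial (Fin n) K)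
          (Ideal.span (Set.range (X : Fin n → MvPolynomial (Fin n) K))) N := by
  let b := Module.Basis.ofVectorSpace K L
  have : Nonempty (Module.Basis.ofVectorSpaceIndex K L) := b.index_nonempty
  let _ : Algebra (MvPolynomial (Fin n) K) (BGS K m n) := (iy K m n).toRingHom.toAlgebra
  let _ : Module (MvPolynomial (Fin n) K) M := Module.compHom M (iy K m n).toRingHom
  have : IsScalarTower (MvPolynomial (Fin n) K) (BGS K m n) M := 
    ⟨fun a s x => mul_smul (iy K m n a) s x⟩
  have : Module.Flat (MvPolynomial (Fin n) K) (BGS K m n) := iy_flat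
  let E : M ≃ₗ[MvPolynomial (Fin n) K] (Module.Basis.ofVectorSpaceIndex K L →₀ N) :=
    { (Eq0 e b).toAddEquiv with
      map_smul' := fun a x => Eq0_smul e hy b a x }
  exact grade_eq E _ _ Q_map

theorem final [Infinite K] [Nontrivial L] [Nontrivial N] (ℒ : ℕ → AddSubgroup L) (hL : IsMvGrading K (Fin m) L ℒ)
    (𝒩 : ℕ → AddSubgroup N) (hN : IsMvGrading K (Fin n) N 𝒩)
    (hx : ∀ (i : Fin m) (u : L) (v : N),
      e ((X (Sum.inl i) : BGS K m n) • e.symm (u ⊗ₜ[K] v))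
        = ((X i : MvPolynomial (Fin m) K) • u) ⊗ₜ[K] v)
    (hy : ∀ (j : Fin n) (u : L) (v : N),
      e ((X (Sum.inr j) : BGS K m n) • e.symm (u ⊗ₜ[K] v))
        = u ⊗ₜ[K] ((X j : MvPolynomial (Fin n) K) • v)) :
    HasMaximalDepth (BGS K m n) (idealQ K m n) M ↔
      ((extGrade (MvPolynomial (Fin n) K)
          (Ideal.span (Set.range (X : Fin n → MvPolynomial (Fin n) K))) N : WithBot ℕ∞)
        = sInf {d : WithBot ℕ∞ | ∃ p ∈ associatedPrimes (MvPolynomial (Fin n) K) N,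
            d = ringKrullDim (MvPolynomial (Fin n) K ⧸ p)}) := by
  have key : ∀ P ∈ associatedPrimes (BGS K m n) M, 
      (cohDim (BGS K m n) (idealQ K m n) (BGS K m n ⧸ P) : WithBot ℕ∞) =
        ringKrullDim (MvPolynomial (Fin n) K ⧸ P.comap (iy K m n)) := by
    intro P hP
    have hd := ass_down e hy P hP
    have := hd.1
    exact cd_main _ (fun f hf i => ass_homog 𝒩 hN _ hd f hf i) P rfl (fun h hh => ass_ev0 e ℒ hL hx hy P hP h hh)
  have hne : (associatedPrimes (BGS K m n) M).Nonempty := by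
    obtain ⟨p, hp⟩ := associatedPrimes.nonempty (MvPolynomial (Fin n) K) N
    obtain ⟨P, hP, -⟩ := ass_up e hx hy p hp
    exact ⟨P, hP⟩
  rw [HasMaximalDepth, mCohDim, grade_main e hy,
    ← sInf_cast (associatedPrimes (BGS K m n) M) hne
      (fun P => cohDim (BGS K m n) (idealQ K m n) (BGS K m n ⧸ P)) _ ?_, Nat.cast_inj]
  ext d
  constructor
  · rintro ⟨p, hp, rfl⟩
    obtain ⟨P, hP, rfl⟩ := ass_up e hx hy p hp
    exact ⟨P, hP, (key P hP).symm⟩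
  · rintro ⟨P, hP, rfl⟩
    exact ⟨_, ass_down e hy P hP, key P hP⟩

end Final
end MaxDepthAux

open TensorProduct in
theorem tensorProduct_maximalDepth_iff
    (K : Type) [Field K] [IsAlgClosed K] (m n : ℕ)
    -- `L`, a nonzero finitely generated graded `K[x]`-module
    (L : Type) [AddCommGroup L] [Module K L] [Module (MvPolynomial (Fin m) K) L]
    [IsScalarTower K (MvPolynomial (Fin m) K) L] [Module.Finite (MvPolynomial (Fin m) K) L]
    [Nontrivial L] (ℒ : ℕ → AddSubgroup L) (hL : IsMvGrading K (Fin m) L ℒ)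
    -- `N`, a nonzero finitely generated graded `K[y]`-module
    (N : Type) [AddCommGroup N] [Module K N] [Module (MvPolynomial (Fin n) K) N]
    [IsScalarTower K (MvPolynomial (Fin n) K) N] [Module.Finite (MvPolynomial (Fin n) K) N]
    [Nontrivial N] (𝒩 : ℕ → AddSubgroup N) (hN : IsMvGrading K (Fin n) N 𝒩)
    -- `M = L ⊗_K N`, regarded as an `S`-module: the variables `x_i` of `S` act as
    -- multiplication by `x_i` on the factor `L`, and the variables `y_j` act as
    -- multiplication by `y_j` on the factor `N`
    (M : Type) [AddCommGroup M] [Module K M] [Module (BGS K m n) M]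
    [IsScalarTower K (BGS K m n) M]
    (e : M ≃ₗ[K] L ⊗[K] N)
    (hx : ∀ (i : Fin m) (u : L) (v : N),
      e ((X (Sum.inl i) : BGS K m n) • e.symm (u ⊗ₜ[K] v))
        = ((X i : MvPolynomial (Fin m) K) • u) ⊗ₜ[K] v)
    (hy : ∀ (j : Fin n) (u : L) (v : N),
      e ((X (Sum.inr j) : BGS K m n) • e.symm (u ⊗ₜ[K] v))
        = u ⊗ₜ[K] ((X j : MvPolynomial (Fin n) K) • v)) :
    HasMaximalDepth (BGS K m n) (idealQ K m n) M ↔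
      ((extGrade (MvPolynomial (Fin n) K)
          (Ideal.span (Set.range (X : Fin n → MvPolynomial (Fin n) K))) N : WithBot ℕ∞)
        = sInf {d : WithBot ℕ∞ | ∃ p ∈ associatedPrimes (MvPolynomial (Fin n) K) N,
            d = ringKrullDim (MvPolynomial (Fin n) K ⧸ p)}) :=
  MaxDepthAux.final e ℒ hL 𝒩 hN hx hy
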